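/- arXiv:2401.11477 — 3 statements merged into one kernel-verified Lean document; each statement's English description precedes it below -/
import Mathlib

section
/- Let Σ = (x̃,ρ,B̃) be an acyclic generalized seed ordered so that b_{ij} ≥ 0 whenever n ≥ i > j ≥ 1. For a ∈ ℤ^n define x^{⟨a⟩} = ∏_{i=1}^{n} x_i^{⟨a_i⟩}, where x_i^{⟨a_i⟩} = x_i^{a_i} if a_i ≥ 0 and x_i^{⟨a_i⟩} = (x_i^{(n)})^{−a_i} if a_i < 0. If a ≺ a′ in the lexicographic order on ℤ^n, then the first Laurent monomial of x^{⟨a⟩} strictly precedes the first Laurent monomial of x^{⟨a′⟩} in the lexicographic order on Laurent monomials in x_1,…,x_n. -/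
open Finset

namespace GCA

/-- Ambient field: the field of rational functions `ℚ(x₁,…,x_m)`. -/
abbrev K (m : ℕ) : Type := FractionRing (MvPolynomial (Fin m) ℚ)

/-- The variables `x₁,…,x_m` inside the ambient field. -/
noncomputable def xv (m : ℕ) (j : Fin m) : K m :=
  algebraMap (MvPolynomial (Fin m) ℚ) (K m) (MvPolynomial.X j)

/-- The coefficient ring `ℤℙ`: the Laurent polynomial ring generated over `ℤ`
by the frozen variables `x_{n+1},…,x_m` and their inverses, as a subalgebra of `K m`. -/
noncomputable def ZP (m n : ℕ) : Subalgebra ℤ (K m) :=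
  Algebra.adjoin ℤ {y | ∃ j : Fin m, n ≤ (j : ℕ) ∧ (y = xv m j ∨ y = (xv m j)⁻¹)}

/-- A (generalized) seed datum: the extended cluster, strings, and the exchange matrix. -/
structure Seed (m n : ℕ) where
  x : Fin m → K m
  ρ : Fin n → ℕ → K m
  B : Matrix (Fin m) (Fin n) ℤ

variable {m n : ℕ}

/-- The exponent `⌊[rβ]₊⌋ + ⌊[−(d−r)β]₊⌋` where `β = b/d`. -/
def mutExp (d : ℕ) (b : ℤ) (r : ℕ) : ℤ :=
  ⌊max ((r : ℚ) * b / d) 0⌋ + ⌊max (-(((d : ℚ) - r) * b / d)) 0⌋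

/-- Matrix mutation in direction `i` of an `m × n` exchange matrix. -/
def matMut (hmn : n ≤ m) (i : Fin n) (B : Matrix (Fin m) (Fin n) ℤ) :
    Matrix (Fin m) (Fin n) ℤ := fun k l =>
  if k = Fin.castLE hmn i ∨ l = i then -B k l
  else B k l + (|B k i| * B (Fin.castLE hmn i) l + B k i * |B (Fin.castLE hmn i) l|) / 2

/-- The exchanged cluster variable `x'_i` of a seed. -/
noncomputable def exchangeVar (hmn : n ≤ m) (d : Fin n → ℕ) (S : Seed m n) (i : Fin n) :
    K m :=
  (S.x (Fin.castLE hmn i))⁻¹ *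
    ∑ r ∈ Finset.range (d i + 1),
      S.ρ i r * ∏ k : Fin m, S.x k ^ mutExp (d i) (S.B k i) r

/-- Seed mutation in direction `i`. -/
noncomputable def Seed.mut (hmn : n ≤ m) (d : Fin n → ℕ) (i : Fin n) (S : Seed m n) :
    Seed m n where
  x := fun j => if j = Fin.castLE hmn i then exchangeVar hmn d S i else S.x j
  ρ := fun j r => if j = i then S.ρ i (d i - r) else S.ρ j r
  B := matMut hmn i S.B

/-- Apply a finite sequence of mutations (left-most applied first). -/
noncomputable def mutSeq (hmn : n ≤ m) (d : Fin n → ℕ) : List (Fin n) → Seed m n → Seed m n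
  | [], S => S
  | i :: l, S => mutSeq hmn d l (Seed.mut hmn d i S)

/-- `seedUpTo hmn d S k = μ_k ⋯ μ_2 μ_1 (S)` (paper's direction `t ∈ [1,n]` is Lean's `t-1`). -/
noncomputable def seedUpTo (hmn : n ≤ m) (d : Fin n → ℕ) (S : Seed m n) : ℕ → Seed m n
  | 0 => S
  | k + 1 => if h : k < n then Seed.mut hmn d ⟨k, h⟩ (seedUpTo hmn d S k) else seedUpTo hmn d S k

/-- The initial seed whose cluster variables are the canonical variables of `ℚ(x₁,…,x_m)`. -/
noncomputable def initSeed (m n : ℕ) (ρ : Fin n → ℕ → K m) (B : Matrix (Fin m) (Fin n) ℤ) :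
    Seed m n := ⟨xv m, ρ, B⟩

/-- The principal part of `B` is skew-symmetrizable. -/
def SkewSymmetrizable (hmn : n ≤ m) (B : Matrix (Fin m) (Fin n) ℤ) : Prop :=
  ∃ D : Fin n → ℤ, (∀ i, 0 < D i) ∧
    ∀ i j : Fin n, D i * B (Fin.castLE hmn i) j = -(D j * B (Fin.castLE hmn j) i)

/-- `p` is a monomial in `ℤ[x_{n+1},…,x_m]`. -/
def IsFrozenMonomial (m n : ℕ) (p : K m) : Prop :=
  ∃ (c : ℤ) (e : Fin m → ℕ), (∀ j : Fin m, (j : ℕ) < n → e j = 0) ∧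
    p = (c : K m) * ∏ j : Fin m, xv m j ^ e j

/-- The defining conditions on the datum `(d, ρ, B)` of a generalized seed of geometric type. -/
structure SeedHyps (m n : ℕ) (hmn : n ≤ m) (d : Fin n → ℕ) (ρ : Fin n → ℕ → K m)
    (B : Matrix (Fin m) (Fin n) ℤ) : Prop where
  d_pos : ∀ i, 0 < d i
  d_dvd : ∀ i j : Fin n, (d i : ℤ) ∣ B (Fin.castLE hmn j) i
  skew : SkewSymmetrizable hmn B
  rho_zero : ∀ i, ρ i 0 = 1
  rho_top : ∀ i, ρ i (d i) = 1
  rho_mon : ∀ i r, r ≤ d i → IsFrozenMonomial m n (ρ i r)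

/-- The edge relation of the directed graph `Γ`: an edge from `i` to `j` iff `b_{ij} > 0`. -/
def GammaEdge (hmn : n ≤ m) (B : Matrix (Fin m) (Fin n) ℤ) (i j : Fin n) : Prop :=
  0 < B (Fin.castLE hmn i) j

/-- The directed graph `Γ` has no oriented cycle. -/
def Acyclic (hmn : n ≤ m) (B : Matrix (Fin m) (Fin n) ℤ) : Prop :=
  ∀ i : Fin n, ¬ Relation.TransGen (GammaEdge hmn B) i i

/-- The ordering normalization: `b_{ij} ≥ 0` whenever `n ≥ i > j ≥ 1`. -/
def Ordered (hmn : n ≤ m) (B : Matrix (Fin m) (Fin n) ℤ) : Prop :=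
  ∀ i j : Fin n, j < i → 0 ≤ B (Fin.castLE hmn i) j

/-- Divisibility inside a subset `R` of the ambient field. -/
def DvdIn (R : Set (K m)) (p u : K m) : Prop := ∃ z ∈ R, u = p * z

/-- `u` and `v` are coprime in `R`: every common divisor in `R` is a unit of `R`. -/
def CoprimeIn (R : Set (K m)) (u v : K m) : Prop :=
  ∀ p ∈ R, DvdIn R p u → DvdIn R p v → ∃ q ∈ R, p * q = 1

/-- The polynomial ring `ℤℙ[x₁,…,x_n]` as a subalgebra of `K m`. -/
noncomputable def polyRing (hmn : n ≤ m) : Subalgebra ℤ (K m) :=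
  Algebra.adjoin ℤ
    ({y | ∃ j : Fin m, n ≤ (j : ℕ) ∧ (y = xv m j ∨ y = (xv m j)⁻¹)} ∪
      {y | ∃ j : Fin n, y = xv m (Fin.castLE hmn j)})

/-- The seed is coprime: the exchange polynomials `x_i x'_i` are pairwise coprime
in `ℤℙ[x₁,…,x_n]`. -/
def CoprimeSeed (hmn : n ≤ m) (d : Fin n → ℕ) (S : Seed m n) : Prop :=
  ∀ i j : Fin n, i ≠ j →
    CoprimeIn (↑(polyRing hmn (m := m)) : Set (K m))
      (S.x (Fin.castLE hmn i) * exchangeVar hmn d S i)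
      (S.x (Fin.castLE hmn j) * exchangeVar hmn d S j)

/-- All cluster variables of all seeds mutation-equivalent to `S`. -/
noncomputable def clusterVars (hmn : n ≤ m) (d : Fin n → ℕ) (S : Seed m n) : Set (K m) :=
  {y | ∃ (L : List (Fin n)) (i : Fin n), y = (mutSeq hmn d L S).x (Fin.castLE hmn i)}

/-- The generalized cluster algebra `𝒜(x̃,ρ,B̃)` as a `ℤℙ`-subalgebra of `ℚ(x₁,…,x_m)`. -/
noncomputable def gca (hmn : n ≤ m) (d : Fin n → ℕ) (S : Seed m n) :
    Subalgebra (↥(ZP m n)) (K m) :=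
  Algebra.adjoin (↥(ZP m n)) (clusterVars hmn d S)

/-- The generalized projective cluster variable `x_i^{(n)}`. -/
noncomputable def projVar (hmn : n ≤ m) (d : Fin n → ℕ) (S : Seed m n) (i : Fin n) : K m :=
  (seedUpTo hmn d S n).x (Fin.castLE hmn i)

/-- The lower bound generalized cluster algebra
`ℒ^{(n)}(Σ) = ℤℙ[x₁, x₁^{(n)}, …, x_n, x_n^{(n)}]`. -/
noncomputable def lowerBound (hmn : n ≤ m) (d : Fin n → ℕ) (S : Seed m n) :
    Subalgebra (↥(ZP m n)) (K m) :=
  Algebra.adjoin (↥(ZP m n))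
    ({y | ∃ i : Fin n, y = S.x (Fin.castLE hmn i)} ∪
      {y | ∃ i : Fin n, y = projVar hmn d S i})

/-- Index type for standard monomials: exponent pairs with no product `x_i x'_i`. -/
def StdIdx (n : ℕ) : Type := {v : Fin n → ℕ × ℕ // ∀ i, (v i).1 = 0 ∨ (v i).2 = 0}

/-- The (projective) standard monomial attached to an exponent vector. -/
noncomputable def stdMon (x x' : Fin n → K m) (v : StdIdx n) : K m :=
  ∏ i : Fin n, x i ^ (v.1 i).1 * x' i ^ (v.1 i).2

/-- Lexicographic order on exponent vectors. -/
def lexLt (a b : Fin n → ℤ) : Prop :=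
  ∃ k : Fin n, a k < b k ∧ ∀ j : Fin n, j < k → a j = b j

/-- The Laurent monomial `x^a = x₁^{a₁} ⋯ x_n^{a_n}`. -/
noncomputable def xpow (hmn : n ≤ m) (a : Fin n → ℤ) : K m :=
  ∏ i : Fin n, xv m (Fin.castLE hmn i) ^ a i

/-- `x^a` is the first Laurent monomial of `Y` (with some nonzero leading
coefficient in `ℤℙ`): `Y = c_a x^a + Σ_v c_v x^v` with all `v ≺ a`. -/
def IsFirstMonomial (hmn : n ≤ m) (Y : K m) (a : Fin n → ℤ) : Prop :=
  ∃ (s : Finset (Fin n → ℤ)) (c : (Fin n → ℤ) → K m),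
    (∀ v, c v ∈ ZP m n) ∧ c a ≠ 0 ∧ (∀ v ∈ s, lexLt v a) ∧
    Y = c a * xpow hmn a + ∑ v ∈ s, c v * xpow hmn v

end GCA

namespace GCA

/-- The monomial `x^{⟨a⟩} = ∏ x_i^{⟨a_i⟩}`, with `x_i^{⟨a_i⟩} = x_i^{a_i}` if `a_i ≥ 0`
and `(x_i^{(n)})^{−a_i}` if `a_i < 0`. -/
noncomputable def xangle {m n : ℕ} (hmn : n ≤ m) (d : Fin n → ℕ) (S : Seed m n)
    (a : Fin n → ℤ) : K m :=
  ∏ i : Fin n,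
    if 0 ≤ a i then xv m (Fin.castLE hmn i) ^ a i else projVar hmn d S i ^ (-a i)

end GCA

namespace GCA
section helpers
variable {m n : ℕ}

noncomputable instance (priority := 10000) modK : Module ℚ (K m) := Algebra.toModule

noncomputable instance (priority := 10001) smulK : SMul ℚ (K m) := Algebra.toSMul

/-- Full Laurent monomials. -/
noncomputable def LX (m : ℕ) (e : Fin m → ℤ) : K m := ∏ j : Fin m, xv m j ^ e j

/-- Restriction of exponents to mutable indices. -/
def rs (hmn : n ≤ m) (e : Fin m → ℤ) : Fin n → ℤ := fun i => e (Fin.castLE hmn i)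

/-- Span of Laurent monomials with mutable exponent in `s`. -/
noncomputable def G (hmn : n ≤ m) (s : Set (Fin n → ℤ)) : Submodule ℚ (K m) :=
  Submodule.span ℚ (LX m '' {e | rs hmn e ∈ s})

theorem xv_ne (j : Fin m) : xv m j ≠ 0 := by
  unfold xv
  intro h
  rw [← map_zero (algebraMap (MvPolynomial (Fin m) ℚ) (K m))] at h
  exact MvPolynomial.X_ne_zero j (IsFractionRing.injective (MvPolynomial (Fin m) ℚ) (K m) h)

theorem LX_add (e f : Fin m → ℤ) : LX m (e + f) = LX m e * LX m f := by
  unfold LX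
  rw [← Finset.prod_mul_distrib]
  exact Finset.prod_congr rfl fun j _ => zpow_add₀ (xv_ne j) _ _

theorem LX_zero : LX m 0 = 1 := by simp [LX]

theorem LX_ne (e : Fin m → ℤ) : LX m e ≠ 0 :=
  Finset.prod_ne_zero_iff.2 fun j _ => zpow_ne_zero _ (xv_ne j)

theorem LX_single (j : Fin m) (z : ℤ) : LX m (Pi.single j z) = xv m j ^ z := by
  unfold LX
  rw [Finset.prod_eq_single j]
  · simp
  · intro b _ hb
    simp [Pi.single_eq_of_ne hb]
  · simp

theorem LX_mem (hmn : n ≤ m) (e : Fin m → ℤ) {s : Set (Fin n → ℤ)} (h : rs hmn e ∈ s) :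
    LX m e ∈ G hmn s := Submodule.subset_span ⟨e, h, rfl⟩

theorem G_mono (hmn : n ≤ m) {s t : Set (Fin n → ℤ)} (h : s ⊆ t) : G hmn s ≤ G hmn t :=
  Submodule.span_mono (Set.image_mono fun _ he => h he)

theorem G_mul (hmn : n ≤ m) {s t r : Set (Fin n → ℤ)} {y z : K m}
    (hy : y ∈ G hmn s) (hz : z ∈ G hmn t) (h : ∀ a ∈ s, ∀ b ∈ t, a + b ∈ r) :
    y * z ∈ G hmn r := by
  have h1 := Submodule.mul_mem_mul hy hz
  unfold G at h1
  rw [Submodule.span_mul_span] at h1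
  refine Submodule.span_le.2 ?_ h1
  rintro _ ⟨_, ⟨e, he, rfl⟩, _, ⟨f, hf, rfl⟩, rfl⟩
  change LX m e * LX m f ∈ _
  rw [← LX_add]
  exact LX_mem hmn _ (h _ he _ hf)

theorem LX_nat (f : Fin m →₀ ℕ) :
    LX m (fun j => (f j : ℤ)) = algebraMap (MvPolynomial (Fin m) ℚ) (K m)
      (MvPolynomial.monomial f 1) := by
  rw [MvPolynomial.monomial_eq, Finsupp.prod_fintype _ _ (by simp)]
  simp [LX, xv]

theorem LX_linInd : LinearIndependent ℚ (LX m) := by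
  classical
  rw [linearIndependent_iff']
  intro s g hg e he
  -- a common shift making all exponents nonnegative
  obtain ⟨N, hN⟩ : ∃ N : Fin m → ℤ, ∀ f ∈ s, ∀ j, 0 ≤ f j + N j := by
    refine ⟨fun j => ∑ f ∈ s, |f j|, fun f hf j => ?_⟩
    have := Finset.single_le_sum (f := fun f : Fin m → ℤ => |f j|)
      (fun f _ => abs_nonneg _) hf
    have h2 := neg_abs_le (f j)
    have h3 : |f j| ≤ ∑ f ∈ s, |f j| := this
    linarith
  let φ : (Fin m → ℤ) → (Fin m →₀ ℕ) := fun f => Finsupp.equivFunOnFinite.symm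
    fun j => (f j + N j).toNat
  have hφ : ∀ f ∈ s, (fun j => ((φ f j : ℕ) : ℤ)) = f + N := by
    intro f hf
    funext j
    simp [φ, hN f hf j]
  have h2 : algebraMap (MvPolynomial (Fin m) ℚ) (K m)
      (∑ f ∈ s, g f • MvPolynomial.monomial (φ f) (1:ℚ)) = 0 := by
    have : (∑ f ∈ s, g f • LX m f) * LX m N = 0 := by rw [hg, zero_mul]
    rw [← this, map_sum, Finset.sum_mul]
    refine Finset.sum_congr rfl fun f hf => ?_
    rw [smul_mul_assoc, ← LX_add, ← hφ f hf, LX_nat]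
    rw [Algebra.smul_def, Algebra.smul_def, map_mul]
    rw [← IsScalarTower.algebraMap_apply]
  rw [← map_zero (algebraMap (MvPolynomial (Fin m) ℚ) (K m))] at h2
  have h3 := IsFractionRing.injective (MvPolynomial (Fin m) ℚ) (K m) h2
  have h4 := congrArg (MvPolynomial.coeff (φ e)) h3
  rw [MvPolynomial.coeff_sum, Finset.sum_eq_single e] at h4
  · simpa using h4
  · intro f hf hne
    rw [MvPolynomial.coeff_smul, MvPolynomial.coeff_monomial, if_neg, smul_zero]
    intro h
    apply hne
    have h5 := hφ f hf
    rw [h, hφ e he] at h5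
    exact (add_right_cancel h5).symm
  · exact fun h => absurd he h

theorem G_disj (hmn : n ≤ m) {s t : Set (Fin n → ℤ)} (h : Disjoint s t) {y : K m}
    (hy : y ∈ G hmn s) (hz : y ∈ G hmn t) : y = 0 := by
  have : Disjoint {e : Fin m → ℤ | rs hmn e ∈ s} {e | rs hmn e ∈ t} := by
    rw [Set.disjoint_left] at h ⊢
    exact fun e he => h he
  exact Submodule.disjoint_def.1 (LX_linInd.disjoint_span_image this) y hy hz

theorem lexLt_irrefl (a : Fin n → ℤ) : ¬ lexLt a a := fun ⟨_, h, _⟩ => lt_irrefl _ h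

theorem lexLt_trans {a b c : Fin n → ℤ} (h : lexLt a b) (h' : lexLt b c) : lexLt a c := by
  obtain ⟨k, hk, hk'⟩ := h
  obtain ⟨l, hl, hl'⟩ := h'
  rcases lt_trichotomy k l with h | h | h
  · exact ⟨k, by rw [← hl' k h]; exact hk, fun j hj => (hk' j hj).trans (hl' j (hj.trans h))⟩
  · subst h
    exact ⟨k, hk.trans hl, fun j hj => (hk' j hj).trans (hl' j hj)⟩
  · exact ⟨l, by rw [hk' l h]; exact hl, fun j hj => (hk' j (hj.trans h)).trans (hl' j hj)⟩

theorem lexLt_of_ne {a b : Fin n → ℤ} (h : a ≠ b) : ∃ k, a k ≠ b k ∧ ∀ j < k, a j = b j := by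
  classical
  have hne : (Finset.univ.filter fun i => a i ≠ b i).Nonempty := by
    obtain ⟨i, hi⟩ := Function.ne_iff.1 h
    exact ⟨i, by simpa using hi⟩
  refine ⟨_, (Finset.mem_filter.1 (Finset.min'_mem _ hne)).2, fun j hj => ?_⟩
  by_contra hc
  exact absurd (Finset.min'_le _ j (by simpa using hc)) (not_le.2 hj)

theorem lexLt_trich {a b : Fin n → ℤ} (h : a ≠ b) : lexLt a b ∨ lexLt b a := by
  obtain ⟨k, hk, hk'⟩ := lexLt_of_ne h
  rcases lt_or_gt_of_ne hk with h | h
  · exact Or.inl ⟨k, h, hk'⟩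
  · exact Or.inr ⟨k, h, fun j hj => (hk' j hj).symm⟩

theorem lexLt_add_left {a b : Fin n → ℤ} (c : Fin n → ℤ) (h : lexLt a b) :
    lexLt (c + a) (c + b) := by
  obtain ⟨k, hk, hk'⟩ := h
  exact ⟨k, by simpa using hk, fun j hj => by simpa using hk' j hj⟩

theorem lexLt_add_right {a b : Fin n → ℤ} (c : Fin n → ℤ) (h : lexLt a b) :
    lexLt (a + c) (b + c) := by
  rw [add_comm a, add_comm b]; exact lexLt_add_left c h

/-- `Y` has nonzero leading part at exponent `u`. -/
def P (hmn : n ≤ m) (Y : K m) (u : Fin n → ℤ) : Prop :=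
  ∃ T ∈ G hmn {u}, T ≠ 0 ∧ Y - T ∈ G hmn {v | lexLt v u}

/-- `Y` is zero or has leading exponent `u`. -/
def Q (hmn : n ≤ m) (Y : K m) (u : Fin n → ℤ) : Prop := Y = 0 ∨ P hmn Y u

theorem P_of_G (hmn : n ≤ m) {Y : K m} {u : Fin n → ℤ} (h : Y ∈ G hmn {u}) (h0 : Y ≠ 0) :
    P hmn Y u := ⟨Y, h, h0, by simp⟩

theorem Q_of_G (hmn : n ≤ m) {Y : K m} {u : Fin n → ℤ} (h : Y ∈ G hmn {u}) : Q hmn Y u := by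
  by_cases h0 : Y = 0
  · exact Or.inl h0
  · exact Or.inr (P_of_G hmn h h0)

theorem one_mem_G (hmn : n ≤ m) : (1 : K m) ∈ G hmn {0} := by
  rw [← LX_zero]; exact LX_mem hmn _ rfl

theorem Q_one (hmn : n ≤ m) : Q hmn 1 0 := Q_of_G hmn (one_mem_G hmn)

theorem P_mul (hmn : n ≤ m) {Y Z : K m} {u v : Fin n → ℤ} (hY : P hmn Y u) (hZ : P hmn Z v) :
    P hmn (Y * Z) (u + v) := by
  obtain ⟨T, hT, hT0, hYT⟩ := hY
  obtain ⟨U, hU, hU0, hZU⟩ := hZ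
  refine ⟨T * U, G_mul hmn hT hU ?_, mul_ne_zero hT0 hU0, ?_⟩
  · rintro _ rfl _ rfl; rfl
  have : Y * Z - T * U = (Y - T) * (Z - U) + (Y - T) * U + T * (Z - U) := by ring
  rw [this]
  refine Submodule.add_mem _ (Submodule.add_mem _ ?_ ?_) ?_
  · refine G_mul hmn hYT hZU fun a ha b hb => ?_
    exact lexLt_trans (lexLt_add_right b ha) (lexLt_add_left u hb)
  · refine G_mul hmn hYT hU fun a ha b hb => ?_
    rw [Set.mem_singleton_iff.1 hb]
    exact lexLt_add_right _ ha
  · refine G_mul hmn hT hZU fun a ha b hb => ?_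
    rw [Set.mem_singleton_iff.1 ha]
    exact lexLt_add_left _ hb

theorem Q_mul (hmn : n ≤ m) {Y Z : K m} {u v : Fin n → ℤ} (hY : Q hmn Y u) (hZ : Q hmn Z v) :
    Q hmn (Y * Z) (u + v) := by
  rcases hY with rfl | hY
  · left; simp
  rcases hZ with rfl | hZ
  · left; simp
  exact Or.inr (P_mul hmn hY hZ)

theorem Q_pow (hmn : n ≤ m) {Y : K m} {u : Fin n → ℤ} (hY : Q hmn Y u) (k : ℕ) :
    Q hmn (Y ^ k) ((k : ℤ) • u) := by
  induction k with
  | zero => simpa using Q_one hmn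
  | succ k ih =>
    rw [pow_succ]
    convert Q_mul hmn ih hY using 1
    push_cast
    rw [add_smul, one_smul]

theorem Q_prod (hmn : n ≤ m) {ι : Type*} (s : Finset ι) (Y : ι → K m) (u : ι → Fin n → ℤ)
    (h : ∀ i ∈ s, Q hmn (Y i) (u i)) : Q hmn (∏ i ∈ s, Y i) (∑ i ∈ s, u i) := by
  classical
  induction s using Finset.induction_on with
  | empty => simpa using Q_one hmn
  | insert i s hi ih =>
    rw [Finset.prod_insert hi, Finset.sum_insert hi]
    exact Q_mul hmn (h i (by simp)) (ih fun j hj => h j (by simp [hj]))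

theorem G_prod (hmn : n ≤ m) {ι : Type*} (s : Finset ι) (Y : ι → K m) (u : ι → Fin n → ℤ)
    (h : ∀ i ∈ s, Y i ∈ G hmn {u i}) : ∏ i ∈ s, Y i ∈ G hmn {∑ i ∈ s, u i} := by
  classical
  induction s using Finset.induction_on with
  | empty => simpa using one_mem_G hmn
  | insert i s hi ih =>
    rw [Finset.prod_insert hi, Finset.sum_insert hi]
    refine G_mul hmn (h i (by simp)) (ih fun j hj => h j (by simp [hj])) ?_
    rintro _ rfl _ rfl; rfl

theorem Q_lower (hmn : n ≤ m) {Y : K m} {u v : Fin n → ℤ} (h : Q hmn Y u) (huv : lexLt u v) :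
    Y ∈ G hmn {w | lexLt w v} := by
  rcases h with rfl | ⟨T, hT, _, h⟩
  · exact Submodule.zero_mem _
  rw [← sub_add_cancel Y T]
  refine Submodule.add_mem _ (G_mono hmn (fun w hw => ?_) h) (G_mono hmn (fun w hw => ?_) hT)
  · exact lexLt_trans hw huv
  · rw [Set.mem_singleton_iff.1 hw]; exact huv

theorem P_ne_zero (hmn : n ≤ m) {Y : K m} {u : Fin n → ℤ} (h : P hmn Y u) {v : Fin n → ℤ}
    (hY : Y ∈ G hmn {w | lexLt w v}) (hv : v = u ∨ lexLt v u) : False := by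
  obtain ⟨T, hT, hT0, h⟩ := h
  apply hT0
  refine G_disj hmn (s := {u}) (t := {w | lexLt w u}) ?_ hT ?_
  · rw [Set.disjoint_singleton_left]; exact lexLt_irrefl u
  · have := Submodule.sub_mem _ (G_mono hmn (t := {w | lexLt w u}) (fun w hw => ?_) hY) h
    · simpa using this
    · rcases hv with rfl | hv
      · exact hw
      · exact lexLt_trans hw hv

theorem P_Q_unique (hmn : n ≤ m) {Y : K m} {u v : Fin n → ℤ} (h : P hmn Y u) (h' : Q hmn Y v) :
    u = v := by
  rcases h' with rfl | h'
  · exact (P_ne_zero hmn h (Submodule.zero_mem _) (Or.inl rfl)).elim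
  by_contra hne
  rcases lexLt_trich hne with hl | hl
  · exact P_ne_zero hmn h' (Q_lower hmn (Or.inr h) hl) (Or.inl rfl)
  · exact P_ne_zero hmn h (Q_lower hmn (Or.inr h') hl) (Or.inl rfl)

theorem xv_zpow_frozen (hmn : n ≤ m) (j : Fin m) (hj : n ≤ (j : ℕ)) (z : ℤ) :
    xv m j ^ z ∈ G hmn {0} := by
  rw [← LX_single]
  refine LX_mem hmn _ ?_
  rw [Set.mem_singleton_iff]
  funext i
  have : Fin.castLE hmn i ≠ j := by
    intro h
    have := congrArg Fin.val h
    simp at this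
    omega
  simp [rs, Pi.single_eq_of_ne this]

theorem xv_zpow_mut (hmn : n ≤ m) (j : Fin n) (z : ℤ) :
    xv m (Fin.castLE hmn j) ^ z ∈ G hmn {Pi.single j z} := by
  rw [← LX_single]
  refine LX_mem hmn _ ?_
  rw [Set.mem_singleton_iff]
  funext i
  simp [rs, Pi.single_apply]

theorem xpow_mem (hmn : n ≤ m) (v : Fin n → ℤ) : xpow hmn v ∈ G hmn {v} := by
  unfold xpow
  have := G_prod hmn Finset.univ (fun i : Fin n => xv m (Fin.castLE hmn i) ^ v i)
    (fun i => Pi.single i (v i)) (fun i _ => xv_zpow_mut hmn i _)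
  rwa [Finset.univ_sum_single] at this

theorem G0_mul (hmn : n ≤ m) {y z : K m} {s : Set (Fin n → ℤ)} (hy : y ∈ G hmn {0})
    (hz : z ∈ G hmn s) : y * z ∈ G hmn s :=
  G_mul hmn hy hz (by rintro _ rfl b hb; simpa using hb)

theorem int_mem_G (hmn : n ≤ m) (c : ℤ) : (c : K m) ∈ G hmn {0} := by
  have : (c : K m) = (c : ℚ) • (1 : K m) := by
    rw [Algebra.smul_def]; simp
  rw [this]
  exact Submodule.smul_mem _ _ (one_mem_G hmn)

theorem ZP_mem (hmn : n ≤ m) {c : K m} (h : c ∈ ZP m n) : c ∈ G hmn {0} := by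
  unfold ZP at h
  induction h using Algebra.adjoin_induction with
  | mem x hx =>
    obtain ⟨j, hj, rfl | rfl⟩ := hx
    · simpa using xv_zpow_frozen hmn j hj 1
    · simpa using xv_zpow_frozen hmn j hj (-1)
  | algebraMap r => simpa using int_mem_G hmn r
  | add x y _ _ hx hy => exact Submodule.add_mem _ hx hy
  | mul x y _ _ hx hy => exact G0_mul hmn hx hy

theorem frozen_mem (hmn : n ≤ m) {p : K m} (h : IsFrozenMonomial m n p) : p ∈ G hmn {0} := by
  obtain ⟨c, e, he, rfl⟩ := h
  refine G0_mul hmn (int_mem_G hmn c) ?_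
  have : ∏ j : Fin m, xv m j ^ e j = LX m fun j => (e j : ℤ) := by simp [LX]
  rw [this]
  refine LX_mem hmn _ ?_
  rw [Set.mem_singleton_iff]
  funext i
  simp [rs, he (Fin.castLE hmn i) (by simp)]

theorem P_of_first (hmn : n ≤ m) {Y : K m} {u : Fin n → ℤ} (h : IsFirstMonomial hmn Y u) :
    P hmn Y u := by
  obtain ⟨s, c, hc, hc0, hs, rfl⟩ := h
  refine ⟨c u * xpow hmn u, G0_mul hmn (ZP_mem hmn (hc u)) (xpow_mem hmn u), mul_ne_zero hc0 ?_, ?_⟩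
  · exact Finset.prod_ne_zero_iff.2 fun j _ => zpow_ne_zero _ (xv_ne _)
  · rw [add_sub_cancel_left]
    refine Submodule.sum_mem _ fun v hv => G0_mul hmn (ZP_mem hmn (hc v)) ?_
    refine G_mono hmn ?_ (xpow_mem hmn v)
    rintro _ rfl
    exact hs _ hv

theorem mutExp_eq (d : ℕ) (hd : 0 < d) (b : ℤ) (hb : 0 ≤ b) (hdvd : (d : ℤ) ∣ b) (r : ℕ)
    (hr : r ≤ d) : mutExp d b r = (r * (b / d).toNat : ℕ) := by
  obtain ⟨q, rfl⟩ := hdvd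
  have hd' : (0:ℚ) < d := by exact_mod_cast hd
  have hq : 0 ≤ q := by
    by_contra hq
    push Not at hq
    have : (d:ℤ) * q < 0 := mul_neg_of_pos_of_neg (by exact_mod_cast hd) hq
    omega
  have hq' : (0:ℚ) ≤ q := by exact_mod_cast hq
  have hr' : (r:ℚ) ≤ d := by exact_mod_cast hr
  have h1 : (r:ℚ) * ((d * q : ℤ) : ℚ) / d = ((r * q : ℤ) : ℚ) := by
    push_cast; field_simp
  have h2 : -(((d:ℚ) - r) * ((d * q : ℤ) : ℚ) / d) = -((d - r) * q) := by
    push_cast; field_simp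
  unfold mutExp
  rw [h1, h2, max_eq_left (by push_cast; positivity), max_eq_right, Int.floor_intCast]
  · rw [Int.mul_ediv_cancel_left _ (by exact_mod_cast hd.ne')]
    simp [hq]
  · have := mul_nonneg (sub_nonneg.2 hr') hq'
    linarith

end helpers
end GCA

namespace GCA
section main
variable {m n : ℕ}

theorem sum_dite_apply (hmn : n ≤ m) (F : Fin n → Fin n → ℤ) (i j : Fin n)
    (h : ∀ l, l ≠ j → F l i = 0) :
    (∑ p : Fin m, if h : (p : ℕ) < n then F ⟨p, h⟩ else 0) i = F j i := by
  rw [Finset.sum_apply, Finset.sum_eq_single (Fin.castLE hmn j)]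
  · simp
  · intro p _ hp
    by_cases hpn : (p : ℕ) < n
    · rw [dif_pos hpn]
      apply h
      rintro rfl
      exact hp rfl
    · simp [dif_neg hpn]
  · simp

theorem exch_lead (hmn : n ≤ m) (d : Fin n → ℕ) (S : Seed m n) (k : Fin n) (hd : 0 < d k)
    (hxf : ∀ p : Fin m, n ≤ (p : ℕ) → S.x p = xv m p)
    (hxge : ∀ i : Fin n, k ≤ i → S.x (Fin.castLE hmn i) = xv m (Fin.castLE hmn i))
    (hxlt : ∀ i : Fin n, i < k → ∃ w : Fin n → ℤ, w i = -1 ∧ (∀ j < i, w j = 0) ∧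
      Q hmn (S.x (Fin.castLE hmn i)) w)
    (hρ0 : S.ρ k 0 = 1) (hρd : S.ρ k (d k) = 1)
    (hρ : ∀ r, r ≤ d k → IsFrozenMonomial m n (S.ρ k r))
    (hb : ∀ j : Fin n, 0 ≤ S.B (Fin.castLE hmn j) k)
    (hdvd : ∀ j : Fin n, (d k : ℤ) ∣ S.B (Fin.castLE hmn j) k)
    (hbkk : S.B (Fin.castLE hmn k) k = 0) :
    ∃ w : Fin n → ℤ, w k = -1 ∧ (∀ j < k, w j = 0) ∧ Q hmn (exchangeVar hmn d S k) w := by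
  classical
  obtain ⟨q, hqdef⟩ : ∃ q : Fin n → ℕ, ∀ j, q j = (S.B (Fin.castLE hmn j) k / d k).toNat :=
    ⟨_, fun _ => rfl⟩
  have hexp : ∀ j r, r ≤ d k →
      mutExp (d k) (S.B (Fin.castLE hmn j) k) r = ((r * q j : ℕ) : ℤ) := by
    intro j r hr
    rw [hqdef]
    exact mutExp_eq (d k) hd _ (hb j) (hdvd j) r hr
  have hqk : q k = 0 := by rw [hqdef, hbkk]; simp
  have hinv : (S.x (Fin.castLE hmn k))⁻¹ ∈ G hmn {Pi.single k (-1)} := by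
    rw [hxge k le_rfl]
    simpa using xv_zpow_mut hmn k (-1)
  have hinv0 : (S.x (Fin.castLE hmn k))⁻¹ ≠ 0 := by
    rw [hxge k le_rfl]
    exact inv_ne_zero (xv_ne _)
  obtain ⟨f, hf⟩ : ∃ f : ℕ → K m, ∀ r, f r = (S.x (Fin.castLE hmn k))⁻¹ *
      (S.ρ k r * ∏ p : Fin m, S.x p ^ mutExp (d k) (S.B p k) r) := ⟨_, fun _ => rfl⟩
  have hex : exchangeVar hmn d S k = ∑ r ∈ Finset.range (d k + 1), f r := by
    unfold exchangeVar
    rw [Finset.mul_sum]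
    exact Finset.sum_congr rfl fun r _ => (hf r).symm
  rw [hex]
  by_cases hA : ∃ j < k, q j ≠ 0
  · -- the constant term dominates
    refine ⟨Pi.single k (-1), by simp, fun j hj => by simp [hj.ne], Or.inr ?_⟩
    have hW : ∀ i : Fin n, ∃ w : Fin n → ℤ, (i < k → w i = -1) ∧ (∀ j < i, w j = 0) ∧
        Q hmn (S.x (Fin.castLE hmn i)) w := by
      intro i
      by_cases hik : i < k
      · obtain ⟨w, h1, h2⟩ := hxlt i hik
        exact ⟨w, fun _ => h1, h2⟩
      · refine ⟨Pi.single i 1, fun h => absurd h hik, fun j hj => by simp [hj.ne], ?_⟩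
        rw [hxge i (not_lt.1 hik)]
        have := xv_zpow_mut hmn i 1
        rw [zpow_one] at this
        exact Q_of_G hmn this
    choose W hW1 hW2 hW3 using hW
    obtain ⟨j0, hj0k, hj0, hj0min⟩ : ∃ j0 < k, q j0 ≠ 0 ∧ ∀ j < j0, q j = 0 := by
      obtain ⟨j, hj, hj'⟩ := hA
      have hne : (fun i => (q i : ℤ)) ≠ 0 := by
        intro h
        exact hj' (by simpa using congrFun h j)
      obtain ⟨l, hl, hl'⟩ := lexLt_of_ne hne
      refine ⟨l, ?_, by simpa using hl, fun j hj => by simpa using hl' j hj⟩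
      by_contra hc
      exact hj' (by simpa using hl' j (lt_of_lt_of_le hj (not_lt.1 hc)))
    rw [Finset.sum_range_succ']
    refine ⟨f 0, ?_, ?_, ?_⟩
    · rw [hf, hρ0, one_mul]
      refine G_mul hmn hinv (t := {0}) ?_ ?_
      · have := G_prod hmn Finset.univ (fun p : Fin m => S.x p ^ mutExp (d k) (S.B p k) 0)
          (fun _ => 0) (fun p _ => ?_)
        · simpa using this
        · by_cases hp : (p : ℕ) < n
          · have := hexp ⟨p, hp⟩ 0 (Nat.zero_le _)
            rw [show Fin.castLE hmn ⟨p, hp⟩ = p from rfl] at this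
            rw [this]
            simpa using one_mem_G hmn
          · rw [hxf p (not_lt.1 hp)]
            exact xv_zpow_frozen hmn p (not_lt.1 hp) _
      · rintro _ rfl _ rfl; simp
    · rw [hf, hρ0, one_mul]
      refine mul_ne_zero hinv0 (Finset.prod_ne_zero_iff.2 fun p _ => ?_)
      by_cases hp : (p : ℕ) < n
      · have := hexp ⟨p, hp⟩ 0 (Nat.zero_le _)
        rw [show Fin.castLE hmn ⟨p, hp⟩ = p from rfl] at this
        rw [this]
        simp
      · rw [hxf p (not_lt.1 hp)]
        exact zpow_ne_zero _ (xv_ne p)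
    · rw [add_sub_cancel_right]
      refine Submodule.sum_mem _ fun r hr => ?_
      have hr' : r + 1 ≤ d k := by simpa [Nat.succ_le_iff] using hr
      set F : Fin n → Fin n → ℤ := fun j => (((r + 1) * q j : ℕ) : ℤ) • W j with hF
      have hprod := Q_prod hmn Finset.univ
        (fun p : Fin m => S.x p ^ mutExp (d k) (S.B p k) (r + 1))
        (fun p => if h : (p : ℕ) < n then F ⟨p, h⟩ else 0) (fun p _ => by
          by_cases hp : (p : ℕ) < n
          · have := hexp ⟨p, hp⟩ _ hr'
            have hw := hW3 ⟨p, hp⟩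
            rw [show Fin.castLE hmn ⟨p, hp⟩ = p from rfl] at this hw
            rw [this, dif_pos hp, zpow_natCast]
            exact Q_pow hmn hw _
          · rw [hxf p (not_lt.1 hp), dif_neg hp]
            exact Q_of_G hmn (xv_zpow_frozen hmn p (not_lt.1 hp) _))
      have hQ := Q_mul hmn (Q_of_G hmn hinv)
        (Q_mul hmn (Q_of_G hmn (frozen_mem hmn (hρ _ hr'))) hprod)
      rw [← hf] at hQ
      refine Q_lower hmn hQ ⟨j0, ?_, fun i hi => ?_⟩
      · have h1 := sum_dite_apply hmn F j0 j0 (fun l hl => by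
          rcases lt_or_gt_of_ne hl with h | h
          · simp [hF, hj0min l h]
          · simp [hF, hW2 l j0 h])
        rw [Pi.add_apply, Pi.add_apply, h1]
        have : 0 < (((r + 1) * q j0 : ℕ) : ℤ) := by
          exact_mod_cast Nat.mul_pos (Nat.succ_pos r) (Nat.pos_of_ne_zero hj0)
        simp only [hF, Pi.smul_apply, hW1 j0 hj0k, smul_eq_mul, Pi.zero_apply]
        linarith
      · have h1 := sum_dite_apply hmn F i i (fun l hl => by
          rcases lt_or_ge l j0 with h | h
          · simp [hF, hj0min l h]
          · simp [hF, hW2 l i (lt_of_lt_of_le hi h)])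
        rw [Pi.add_apply, Pi.add_apply, h1]
        simp [hF, hj0min i hi]
  · -- no earlier neighbours: all terms are Laurent monomials
    push Not at hA
    have hterm : ∀ r ≤ d k, f r ∈ G hmn {Pi.single k (-1) + (r : ℤ) • fun i => (q i : ℤ)} := by
      intro r hr
      set F : Fin n → Fin n → ℤ := fun j => Pi.single j ((r * q j : ℕ) : ℤ) with hF
      have hprod := G_prod hmn Finset.univ
        (fun p : Fin m => S.x p ^ mutExp (d k) (S.B p k) r)
        (fun p => if h : (p : ℕ) < n then F ⟨p, h⟩ else 0) (fun p _ => by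
          by_cases hp : (p : ℕ) < n
          · have h1 := hexp ⟨p, hp⟩ _ hr
            rw [show Fin.castLE hmn ⟨p, hp⟩ = p from rfl] at h1
            rw [h1, dif_pos hp]
            by_cases hpk : (⟨p, hp⟩ : Fin n) < k
            · simpa [hF, hA _ hpk] using one_mem_G hmn
            · have h2 := hxge ⟨p, hp⟩ (not_lt.1 hpk)
              rw [show Fin.castLE hmn ⟨p, hp⟩ = p from rfl] at h2
              rw [h2]
              exact xv_zpow_mut hmn ⟨p, hp⟩ _
          · rw [hxf p (not_lt.1 hp), dif_neg hp]
            exact xv_zpow_frozen hmn p (not_lt.1 hp) _)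
      rw [hf]
      refine G_mul hmn hinv (G0_mul hmn (frozen_mem hmn (hρ _ hr)) hprod) ?_
      rintro _ rfl _ rfl
      rw [Set.mem_singleton_iff]
      congr 1
      funext i
      rw [sum_dite_apply hmn F i i (fun l hl => by simp [hF, hl.symm])]
      simp [hF]
    by_cases hq0 : (fun i => (q i : ℤ)) = 0
    · refine ⟨Pi.single k (-1), by simp, fun j hj => by simp [hj.ne], Q_of_G hmn ?_⟩
      refine Submodule.sum_mem _ fun r hr => ?_
      have := hterm r (Nat.lt_succ_iff.1 (Finset.mem_range.1 hr))
      rwa [hq0, smul_zero, add_zero] at this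
    · refine ⟨_, ?_, ?_, Or.inr ⟨f (d k), hterm _ le_rfl, ?_, ?_⟩⟩
      · simp [hqk]
      · intro j hj
        simp [hj.ne, hA j hj]
      · rw [hf, hρd, one_mul]
        refine mul_ne_zero hinv0 (Finset.prod_ne_zero_iff.2 fun p _ => ?_)
        by_cases hp : (p : ℕ) < n
        · by_cases hpk : (⟨p, hp⟩ : Fin n) < k
          · have h1 := hexp ⟨p, hp⟩ _ le_rfl
            rw [show Fin.castLE hmn ⟨p, hp⟩ = p from rfl] at h1
            rw [h1, hA _ hpk]
            simp
          · have h2 := hxge ⟨p, hp⟩ (not_lt.1 hpk)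
            rw [show Fin.castLE hmn ⟨p, hp⟩ = p from rfl] at h2
            rw [h2]
            exact zpow_ne_zero _ (xv_ne p)
        · rw [hxf p (not_lt.1 hp)]
          exact zpow_ne_zero _ (xv_ne p)
      · rw [Finset.sum_range_succ, add_sub_cancel_right]
        refine Submodule.sum_mem _ fun r hr => ?_
        have hr' := Finset.mem_range.1 hr
        refine Q_lower hmn (Q_of_G hmn (hterm r hr'.le)) (lexLt_add_left _ ?_)
        obtain ⟨l, hl, hl'⟩ := lexLt_of_ne hq0
        refine ⟨l, ?_, fun j hj => ?_⟩
        · simp only [Pi.smul_apply, smul_eq_mul]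
          have h1 : 0 < q l := Nat.pos_of_ne_zero (by simpa using hl)
          exact_mod_cast Nat.mul_lt_mul_of_pos_right hr' h1
        · have : q j = 0 := by simpa using hl' j hj
          simp [this]

/-- Invariants of the seeds along the mutation sequence. -/
structure Inv (hmn : n ≤ m) (ρ : Fin n → ℕ → K m) (B : Matrix (Fin m) (Fin n) ℤ)
    (k : ℕ) (S : Seed m n) : Prop where
  xf : ∀ p : Fin m, n ≤ (p : ℕ) → S.x p = xv m p
  xge : ∀ i : Fin n, k ≤ (i : ℕ) → S.x (Fin.castLE hmn i) = xv m (Fin.castLE hmn i)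
  xlt : ∀ i : Fin n, (i : ℕ) < k → ∃ w : Fin n → ℤ, w i = -1 ∧ (∀ j < i, w j = 0) ∧
      Q hmn (S.x (Fin.castLE hmn i)) w
  rho : ∀ i : Fin n, k ≤ (i : ℕ) → S.ρ i = ρ i
  mat : ∀ i j : Fin n, S.B (Fin.castLE hmn i) j =
    if ((i : ℕ) < k ↔ (j : ℕ) < k) then B (Fin.castLE hmn i) j else -B (Fin.castLE hmn i) j

theorem inv_all (hmn : n ≤ m) (d : Fin n → ℕ) (ρ : Fin n → ℕ → K m)
    (B : Matrix (Fin m) (Fin n) ℤ) (hseed : SeedHyps m n hmn d ρ B) (hord : Ordered hmn B) :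
    ∀ k ≤ n, Inv hmn ρ B k (seedUpTo hmn d (initSeed m n ρ B) k) := by
  obtain ⟨D, hD, hskew⟩ := hseed.skew
  have hdiag : ∀ i : Fin n, B (Fin.castLE hmn i) i = 0 := by
    intro i
    have h1 := hskew i i
    have h2 : D i * B (Fin.castLE hmn i) i = 0 := by linarith
    exact (mul_eq_zero.1 h2).resolve_left (hD i).ne'
  have hup : ∀ i j : Fin n, i < j → B (Fin.castLE hmn i) j ≤ 0 := by
    intro i j hij
    have h1 := hskew i j
    have h2 := mul_nonneg (hD j).le (hord j i hij)
    by_contra hc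
    have := mul_pos (hD i) (not_le.1 hc)
    linarith
  intro k
  induction k with
  | zero =>
    intro _
    exact ⟨fun _ _ => rfl, fun _ _ => rfl, fun i hi => absurd hi (Nat.not_lt_zero _),
      fun _ _ => rfl, fun i j => by simp [seedUpTo, initSeed]⟩
  | succ k ih =>
    intro hk
    have hkn : k < n := hk
    have I := ih hkn.le
    have hS : seedUpTo hmn d (initSeed m n ρ B) (k + 1) =
        Seed.mut hmn d ⟨k, hkn⟩ (seedUpTo hmn d (initSeed m n ρ B) k) := by
      rw [seedUpTo, dif_pos hkn]
    rw [hS]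
    generalize seedUpTo hmn d (initSeed m n ρ B) k = S at I
    obtain ⟨κ, hκ⟩ : ∃ κ : Fin n, κ = ⟨k, hkn⟩ := ⟨_, rfl⟩
    have hκv : (κ : ℕ) = k := by rw [hκ]
    rw [← hκ]
    have hcol : ∀ j : Fin n, 0 ≤ S.B (Fin.castLE hmn j) κ := by
      intro j
      rw [I.mat]
      rcases lt_trichotomy j κ with h | h | h
      · have h' : (j : ℕ) < κ := h
        rw [if_neg (by omega)]
        have := hup j κ h
        omega
      · rw [h, if_pos Iff.rfl, hdiag]
      · have h' : (κ : ℕ) < j := h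
        rw [if_pos (by omega)]
        exact hord j κ h
    have hrow : ∀ j : Fin n, S.B (Fin.castLE hmn κ) j ≤ 0 := by
      intro j
      rw [I.mat]
      rcases lt_trichotomy j κ with h | h | h
      · have h' : (j : ℕ) < κ := h
        rw [if_neg (by omega)]
        have := hord κ j h
        omega
      · rw [h, if_pos Iff.rfl, hdiag]
      · have h' : (κ : ℕ) < j := h
        rw [if_pos (by omega)]
        exact hup κ j h
    have hcast : ∀ i : Fin n, Fin.castLE hmn i = Fin.castLE hmn κ ↔ i = κ := by
      intro i
      simp [Fin.ext_iff]
    have hrhoκ : S.ρ κ = ρ κ := I.rho κ hκv.ge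
    have key := exch_lead hmn d S κ (hseed.d_pos κ) I.xf
      (fun i hi => I.xge i (by have : (κ : ℕ) ≤ i := hi; omega))
      (fun i hi => I.xlt i (by have : (i : ℕ) < κ := hi; omega))
      (by rw [hrhoκ]; exact hseed.rho_zero κ) (by rw [hrhoκ]; exact hseed.rho_top κ)
      (by rw [hrhoκ]; exact hseed.rho_mon κ) hcol
      (fun j => by
        rw [I.mat]
        split_ifs
        · exact hseed.d_dvd κ j
        · exact (dvd_neg).2 (hseed.d_dvd κ j))
      (by rw [I.mat, if_pos Iff.rfl, hdiag])
    refine ⟨fun p hp => ?_, fun i hi => ?_, fun i hi => ?_, fun i hi => ?_, fun i j => ?_⟩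
    · have : p ≠ Fin.castLE hmn κ := by
        intro h
        have := congrArg Fin.val h
        simp at this
        omega
      simp only [Seed.mut, if_neg this]
      exact I.xf p hp
    · have : i ≠ κ := by rintro rfl; omega
      simp only [Seed.mut, hcast, if_neg this]
      exact I.xge i (by omega)
    · by_cases h : i = κ
      · rw [h]
        simpa [Seed.mut] using key
      · simp only [Seed.mut, hcast, if_neg h]
        refine I.xlt i ?_
        have : (i : ℕ) ≠ κ := fun h' => h (Fin.ext h')
        omega
    · have : i ≠ κ := by rintro rfl; omega
      simp only [Seed.mut, if_neg this]
      exact I.rho i (by omega)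
    · simp only [Seed.mut, matMut, hcast]
      by_cases hi : i = κ
      · rw [if_pos (Or.inl hi), I.mat, hi]
        by_cases hj : j = κ
        · rw [hj, hdiag]; simp
        · have : (j : ℕ) ≠ κ := fun h' => hj (Fin.ext h')
          by_cases hlt : (j : ℕ) < k
          · rw [if_neg (by omega), if_pos (by omega), neg_neg]
          · rw [if_pos (by omega), if_neg (by omega)]
      · have hi' : (i : ℕ) ≠ κ := fun h' => hi (Fin.ext h')
        by_cases hj : j = κ
        · rw [if_pos (Or.inr hj), I.mat, hj]
          by_cases hlt : (i : ℕ) < k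
          · rw [if_neg (by omega), if_pos (by omega), neg_neg]
          · rw [if_pos (by omega), if_neg (by omega)]
        · have hj' : (j : ℕ) ≠ κ := fun h' => hj (Fin.ext h')
          rw [if_neg (by tauto), abs_of_nonneg (hcol i), abs_of_nonpos (hrow j)]
          rw [show S.B (Fin.castLE hmn i) κ * S.B (Fin.castLE hmn κ) j +
            S.B (Fin.castLE hmn i) κ * -S.B (Fin.castLE hmn κ) j = 0 by ring]
          rw [Int.zero_ediv, add_zero, I.mat]
          congr 1
          apply propext
          omega

end main
end GCA

open GCA in
/-- For an acyclic generalized seed ordered so that `b_{ij} ≥ 0`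
whenever `i > j`: if `a ≺ a′` lexicographically, then the first Laurent monomial of
`x^{⟨a⟩}` strictly precedes the first Laurent monomial of `x^{⟨a′⟩}`. -/
theorem firstMonomial_xangle_strictMono {m n : ℕ} (hn : 1 ≤ n) (hmn : n ≤ m)
    (d : Fin n → ℕ) (ρ : Fin n → ℕ → K m) (B : Matrix (Fin m) (Fin n) ℤ)
    (hseed : SeedHyps m n hmn d ρ B)
    (hacyc : Acyclic hmn B) (hord : Ordered hmn B)
    (a a' : Fin n → ℤ) (hlt : lexLt a a') (u u' : Fin n → ℤ)
    (hu : IsFirstMonomial hmn (xangle hmn d (initSeed m n ρ B) a) u)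
    (hu' : IsFirstMonomial hmn (xangle hmn d (initSeed m n ρ B) a') u') :
    lexLt u u' := by
  classical
  have I := inv_all hmn d ρ B hseed hord n le_rfl
  have hW := fun i : Fin n => I.xlt i i.2
  choose w hw1 hw2 hw3 using hW
  -- exponent vector contributed by index `i` with value `t`
  obtain ⟨V, hV⟩ : ∃ V : Fin n → ℤ → Fin n → ℤ, ∀ i t,
      V i t = if 0 ≤ t then Pi.single i t else (-t) • w i := ⟨_, fun _ _ => rfl⟩
  have hVi : ∀ i t, V i t i = t := by
    intro i t
    rw [hV]
    split_ifs
    · simp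
    · simp [hw1]
  have hVj : ∀ i t, ∀ j < i, V i t j = 0 := by
    intro i t j hj
    rw [hV]
    split_ifs
    · simp [hj.ne]
    · simp [hw2 i j hj]
  have hQ : ∀ b : Fin n → ℤ, Q hmn (xangle hmn d (initSeed m n ρ B) b) (∑ i, V i (b i)) := by
    intro b
    unfold xangle
    refine Q_prod hmn _ _ _ fun i _ => ?_
    rw [hV]
    split_ifs with h
    · exact Q_of_G hmn (xv_zpow_mut hmn i _)
    · obtain ⟨t, ht⟩ := Int.eq_ofNat_of_zero_le (a := -b i) (by omega)
      rw [ht, zpow_natCast]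
      exact Q_pow hmn (hw3 i) t
  have e1 := P_Q_unique hmn (P_of_first hmn hu) (hQ a)
  have e2 := P_Q_unique hmn (P_of_first hmn hu') (hQ a')
  rw [e1, e2]
  obtain ⟨k, hk, hk'⟩ := hlt
  have hterm : ∀ i j : Fin n, j ≤ k → i ≠ k → V i (a i) j = V i (a' i) j := by
    intro i j hj hik
    rcases lt_or_gt_of_ne hik with h | h
    · rw [hk' i h]
    · rw [hVj i _ j (lt_of_le_of_lt hj h), hVj i _ j (lt_of_le_of_lt hj h)]
  refine ⟨k, ?_, fun j hj => ?_⟩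
  · rw [Finset.sum_apply, Finset.sum_apply]
    refine Finset.sum_lt_sum (fun i _ => ?_) ⟨k, Finset.mem_univ _, ?_⟩
    · by_cases hik : i = k
      · rw [hik, hVi, hVi]; exact hk.le
      · exact (hterm i k le_rfl hik).le
    · rw [hVi, hVi]; exact hk
  · rw [Finset.sum_apply, Finset.sum_apply]
    refine Finset.sum_congr rfl fun i _ => ?_
    by_cases hik : i = k
    · rw [hik, hVj k _ j hj, hVj k _ j hj]
    · exact hterm i j hj.le hik
end

section
/- Let (x̃,ρ,B̃) be a generalized seed with b_{32} > 0, b_{21} > 0 and b_{13} > 0 (so in particular b_{12}, b_{23}, b_{31} < 0 by skew-symmetrizability). For i ∈ {1,2,3} and r ∈ [0,d_i] set P_{i,r} = ρ_{i,r} ∏_{j=4}^{n} x_j^{r[β_{ji}]_+ + (d_i−r)[−β_{ji}]_+} ∏_{j=n+1}^{m} x_j^{⌊[rβ_{ji}]_+⌋ + ⌊[(d_i−r)(−β_{ji})]_+⌋}. Then x'_1 x'_2 x'_3 = P_{1,0} P_{3,d_3} x'_2 x_1^{b_{13}−1} x_3^{−b_{31}−1} + P_{1,d_1} P_{2,0}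 x_1^{−b_{12}−1} x_2^{b_{21}−1} x'_3 + P_{2,d_2} P_{3,0} x'_1 x_2^{−b_{23}−1} x_3^{b_{32}−1} + A, where A is a polynomial in ℤℙ[x_1, …, x_n]. Consequently the standard monomials in x_1,x'_1,…,x_n,x'_n are linearly dependent over ℤℙ. -/
open Finset

namespace GCA

/-- The coefficient `P_{i,r} = ρ_{i,r} ∏_{j=4}^{n} x_j^{r[β_{ji}]₊ + (d_i−r)[−β_{ji}]₊}
∏_{j=n+1}^{m} x_j^{⌊[rβ_{ji}]₊⌋ + ⌊[(d_i−r)(−β_{ji})]₊⌋}`. -/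
noncomputable def Pcoef {m n : ℕ} (hmn : n ≤ m) (d : Fin n → ℕ) (ρ : Fin n → ℕ → K m)
    (B : Matrix (Fin m) (Fin n) ℤ) (i : Fin n) (r : ℕ) : K m :=
  ρ i r *
    (∏ j ∈ Finset.univ.filter (fun j : Fin n => 3 ≤ (j : ℕ)),
      xv m (Fin.castLE hmn j) ^
        ((r : ℤ) * max (B (Fin.castLE hmn j) i / (d i : ℤ)) 0 +
          ((d i : ℤ) - (r : ℤ)) * max (-(B (Fin.castLE hmn j) i / (d i : ℤ))) 0)) *
    (∏ j ∈ Finset.univ.filter (fun j : Fin m => n ≤ (j : ℕ)),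
      xv m j ^
        (⌊max ((r : ℚ) * (B j i : ℚ) / (d i : ℚ)) 0⌋ +
          ⌊max (((d i : ℚ) - (r : ℚ)) * (-(B j i : ℚ)) / (d i : ℚ)) 0⌋))

end GCA

namespace GCA

/-- The subring of polynomials in the cluster variables indexed by `T`. -/
noncomputable def RR {m n : ℕ} (hmn : n ≤ m) (T : Set (Fin n)) : Subalgebra (↥(ZP m n)) (K m) :=
  Algebra.adjoin (↥(ZP m n)) {y | ∃ j : Fin n, j ∈ T ∧ y = xv m (Fin.castLE hmn j)}

theorem xv_ne_zero (m : ℕ) (j : Fin m) : xv m j ≠ 0 := by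
  unfold xv
  intro h
  have := (IsFractionRing.injective (MvPolynomial (Fin m) ℚ) (K m)) (h.trans (map_zero _).symm)
  exact MvPolynomial.X_ne_zero j this

theorem RR_mono {m n : ℕ} (hmn : n ≤ m) {T T' : Set (Fin n)} (h : T ⊆ T') :
    RR hmn T ≤ RR hmn T' := by
  apply Algebra.adjoin_mono
  rintro y ⟨j, hj, rfl⟩
  exact ⟨j, h hj, rfl⟩

theorem xv_mem_RR {m n : ℕ} (hmn : n ≤ m) {T : Set (Fin n)} {j : Fin n} (h : j ∈ T) :
    xv m (Fin.castLE hmn j) ∈ RR hmn T :=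
  Algebra.subset_adjoin ⟨j, h, rfl⟩

theorem ZP_mem_RR {m n : ℕ} (hmn : n ≤ m) {T : Set (Fin n)} {y : K m} (h : y ∈ ZP m n) :
    y ∈ RR hmn T :=
  (RR hmn T).algebraMap_mem (⟨y, h⟩ : ↥(ZP m n))

theorem frozen_zpow_mem {m n : ℕ} {j : Fin m} (h : n ≤ (j : ℕ)) (e : ℤ) :
    xv m j ^ e ∈ ZP m n := by
  have h1 : xv m j ∈ ZP m n := Algebra.subset_adjoin ⟨j, h, Or.inl rfl⟩
  have h2 : (xv m j)⁻¹ ∈ ZP m n := Algebra.subset_adjoin ⟨j, h, Or.inr rfl⟩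
  obtain ⟨k, rfl | rfl⟩ := e.eq_nat_or_neg
  · rw [zpow_natCast]; exact pow_mem h1 k
  · rw [zpow_neg, zpow_natCast, ← inv_pow]; exact pow_mem h2 k

theorem frozenMonomial_mem {m n : ℕ} {p : K m} (h : IsFrozenMonomial m n p) : p ∈ ZP m n := by
  obtain ⟨c, e, he, rfl⟩ := h
  refine mul_mem (intCast_mem _ c) (prod_mem fun j _ => ?_)
  by_cases hj : (j : ℕ) < n
  · rw [he j hj, pow_zero]; exact one_mem _
  · have := frozen_zpow_mem (n := n) (not_lt.mp hj) (e j : ℤ)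
    rwa [zpow_natCast] at this

theorem zpow_mem_RR {m n : ℕ} (hmn : n ≤ m) {T : Set (Fin n)} {j : Fin n} (h : j ∈ T)
    {e : ℤ} (he : 0 ≤ e) : xv m (Fin.castLE hmn j) ^ e ∈ RR hmn T := by
  lift e to ℕ using he
  rw [zpow_natCast]
  exact pow_mem (xv_mem_RR hmn h) e

theorem Pcoef_mem {m n : ℕ} (hmn : n ≤ m) {d : Fin n → ℕ} {ρ : Fin n → ℕ → K m}
    {B : Matrix (Fin m) (Fin n) ℤ} (hseed : SeedHyps m n hmn d ρ B) (i : Fin n) {r : ℕ}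
    (hr : r ≤ d i) {T : Set (Fin n)} (hT : ∀ j : Fin n, 3 ≤ (j : ℕ) → j ∈ T) :
    Pcoef hmn d ρ B i r ∈ RR hmn T := by
  unfold Pcoef
  refine mul_mem (mul_mem ?_ (prod_mem fun j hj => ?_)) (prod_mem fun j hj => ?_)
  · exact ZP_mem_RR hmn (frozenMonomial_mem (hseed.rho_mon i r hr))
  · simp only [Finset.mem_filter, Finset.mem_univ, true_and] at hj
    refine zpow_mem_RR hmn (hT j hj) ?_
    have : (0 : ℤ) ≤ (d i : ℤ) - r := by omega
    positivity
  · simp only [Finset.mem_filter, Finset.mem_univ, true_and] at hj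
    exact ZP_mem_RR hmn (frozen_zpow_mem hj _)

theorem mutExp_eq_s16 (d : ℕ) (hd : 0 < d) (q : ℤ) (r : ℕ) (hr : r ≤ d) :
    mutExp d ((d : ℤ) * q) r = (r : ℤ) * max q 0 + ((d : ℤ) - r) * max (-q) 0 := by
  have hd' : (d : ℚ) ≠ 0 := by positivity
  have e1 : (r : ℚ) * ((d * q : ℤ) : ℚ) / d = ((r * q : ℤ) : ℚ) := by
    push_cast; field_simp
  have e2 : -(((d : ℚ) - r) * ((d * q : ℤ) : ℚ) / d) = (((d - r) * (-q) : ℤ) : ℚ) := by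
    push_cast; field_simp
  have h1 : (0 : ℤ) ≤ (d : ℤ) - r := by omega
  unfold mutExp
  rw [e1, e2]
  have c1 : max ((r * q : ℤ) : ℚ) 0 = ((max (r * q) 0 : ℤ) : ℚ) := by push_cast; rfl
  have c2 : max (((d - r) * (-q) : ℤ) : ℚ) 0 = ((max ((d - r) * (-q)) 0 : ℤ) : ℚ) := by
    push_cast; rfl
  rw [c1, c2, Int.floor_intCast, Int.floor_intCast, mul_max_of_nonneg _ _ h1,
    mul_max_of_nonneg _ _ (Int.natCast_nonneg r), mul_zero, mul_zero]

/-- Splitting a product over all variables. -/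
theorem prod_split {m n : ℕ} (hmn : n ≤ m) (f : Fin m → K m) (i j k : Fin n)
    (hi : (i : ℕ) < 3) (hj : (j : ℕ) < 3) (hk : (k : ℕ) < 3) (hij : i ≠ j) (hik : i ≠ k)
    (hjk : j ≠ k) :
    ∏ t : Fin m, f t =
      (f (Fin.castLE hmn i) * f (Fin.castLE hmn j) * f (Fin.castLE hmn k)) *
      (∏ t ∈ Finset.univ.filter (fun t : Fin n => 3 ≤ (t : ℕ)), f (Fin.castLE hmn t)) *
      (∏ t ∈ Finset.univ.filter (fun t : Fin m => n ≤ (t : ℕ)), f t) := by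
  have hlow : Finset.univ.filter (fun t : Fin n => ¬ 3 ≤ (t : ℕ)) = {i, j, k} := by
    ext t
    simp only [Finset.mem_filter, Finset.mem_univ, true_and, Finset.mem_insert,
      Finset.mem_singleton]
    rw [Fin.ext_iff, Fin.ext_iff, Fin.ext_iff]
    rw [Ne, Fin.ext_iff] at hij hik hjk
    omega
  have h1 : ∏ t ∈ Finset.univ.filter (fun t : Fin m => ¬ n ≤ (t : ℕ)), f t =
      ∏ t : Fin n, f (Fin.castLE hmn t) := by
    symm
    refine Finset.prod_bij (fun t _ => Fin.castLE hmn t) ?_ ?_ ?_ ?_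
    · intro t _; simp
    · intro a _ b _ h; exact Fin.castLE_injective hmn h
    · intro b hb
      simp only [Finset.mem_filter, Finset.mem_univ, true_and, not_le] at hb
      exact ⟨⟨b, hb⟩, Finset.mem_univ _, rfl⟩
    · intros; rfl
  rw [← Finset.prod_filter_mul_prod_filter_not Finset.univ (fun t : Fin m => n ≤ (t : ℕ)) f, h1,
    ← Finset.prod_filter_mul_prod_filter_not Finset.univ (fun t : Fin n => 3 ≤ (t : ℕ))
      (fun t => f (Fin.castLE hmn t)), hlow,
    Finset.prod_insert (by simp [hij, hik]), Finset.prod_insert (by simp [hjk]),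
    Finset.prod_singleton]
  ring

theorem term_eq {m n : ℕ} (hmn : n ≤ m) {d : Fin n → ℕ} {ρ : Fin n → ℕ → K m}
    {B : Matrix (Fin m) (Fin n) ℤ} (hseed : SeedHyps m n hmn d ρ B) (i j k : Fin n)
    (hi : (i : ℕ) < 3) (hj : (j : ℕ) < 3) (hk : (k : ℕ) < 3) (hij : i ≠ j) (hik : i ≠ k)
    (hjk : j ≠ k) (q p : ℤ) (hq : 0 < q) (hp : 0 < p)
    (hjq : B (Fin.castLE hmn j) i = d i * q) (hkp : B (Fin.castLE hmn k) i = d i * (-p))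
    (r : ℕ) (hr : r ≤ d i) :
    ρ i r * ∏ t : Fin m, xv m t ^ mutExp (d i) (B t i) r =
      Pcoef hmn d ρ B i r * xv m (Fin.castLE hmn j) ^ ((r : ℤ) * q) *
        xv m (Fin.castLE hmn k) ^ (((d i : ℤ) - r) * p) := by
  have hd := hseed.d_pos i
  have hii : B (Fin.castLE hmn i) i = d i * 0 := by
    obtain ⟨D, hD, hs⟩ := hseed.skew
    have := hs i i
    have h2 : D i * B (Fin.castLE hmn i) i = 0 := by omega
    rw [mul_zero]
    exact (mul_eq_zero.mp h2).resolve_left (hD i).ne'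
  rw [prod_split hmn _ i j k hi hj hk hij hik hjk, hii, hjq, hkp, mutExp_eq_s16 _ hd _ _ hr,
    mutExp_eq_s16 _ hd _ _ hr, mutExp_eq_s16 _ hd _ _ hr]
  have e1 : max q 0 = q := max_eq_left hq.le
  have e2 : max (-q) 0 = 0 := max_eq_right (by omega)
  have e3 : max (-p) 0 = 0 := max_eq_right (by omega)
  have e4 : max (- -p) 0 = p := by rw [neg_neg]; exact max_eq_left hp.le
  rw [e1, e2, e3, e4]
  have hmid : ∏ t ∈ Finset.univ.filter (fun t : Fin n => 3 ≤ (t : ℕ)),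
        xv m (Fin.castLE hmn t) ^ mutExp (d i) (B (Fin.castLE hmn t) i) r =
      ∏ t ∈ Finset.univ.filter (fun t : Fin n => 3 ≤ (t : ℕ)),
        xv m (Fin.castLE hmn t) ^
        ((r : ℤ) * max (B (Fin.castLE hmn t) i / (d i : ℤ)) 0 +
          ((d i : ℤ) - (r : ℤ)) * max (-(B (Fin.castLE hmn t) i / (d i : ℤ))) 0) := by
    refine Finset.prod_congr rfl fun t _ => ?_
    obtain ⟨c, hc⟩ := hseed.d_dvd i t
    rw [hc, mutExp_eq_s16 _ hd _ _ hr, Int.mul_ediv_cancel_left _ (by omega)]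
  have hfr : ∏ t ∈ Finset.univ.filter (fun t : Fin m => n ≤ (t : ℕ)),
        xv m t ^ mutExp (d i) (B t i) r =
      ∏ t ∈ Finset.univ.filter (fun t : Fin m => n ≤ (t : ℕ)), xv m t ^
        (⌊max ((r : ℚ) * (B t i : ℚ) / (d i : ℚ)) 0⌋ +
          ⌊max (((d i : ℚ) - (r : ℚ)) * (-(B t i : ℚ)) / (d i : ℚ)) 0⌋) := by
    refine Finset.prod_congr rfl fun t _ => ?_
    unfold mutExp
    rw [mul_neg, neg_div]
  rw [hmid, hfr]
  unfold Pcoef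
  simp only [max_self, neg_zero, mul_zero, add_zero, zero_add, zpow_zero, one_mul]
  ring

theorem exch_eq {m n : ℕ} (hmn : n ≤ m) {d : Fin n → ℕ} {ρ : Fin n → ℕ → K m}
    {B : Matrix (Fin m) (Fin n) ℤ} (hseed : SeedHyps m n hmn d ρ B) (i j k : Fin n)
    (hi : (i : ℕ) < 3) (hj : (j : ℕ) < 3) (hk : (k : ℕ) < 3) (hij : i ≠ j) (hik : i ≠ k)
    (hjk : j ≠ k) (q p : ℕ)
    (hjq : B (Fin.castLE hmn j) i = q + 1) (hkp : B (Fin.castLE hmn k) i = -(p + 1)) :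
    ∃ M ∈ RR hmn (Set.univ : Set (Fin n)), exchangeVar hmn d (initSeed m n ρ B) i =
      (xv m (Fin.castLE hmn i))⁻¹ *
        (Pcoef hmn d ρ B i 0 * xv m (Fin.castLE hmn k) ^ (p + 1) +
          xv m (Fin.castLE hmn j) * xv m (Fin.castLE hmn k) * M +
          Pcoef hmn d ρ B i (d i) * xv m (Fin.castLE hmn j) ^ (q + 1)) := by
  have hd := hseed.d_pos i
  have hdZ : (0 : ℤ) < d i := by exact_mod_cast hd
  obtain ⟨q', hq'⟩ := hseed.d_dvd i j
  obtain ⟨p'', hp''⟩ := hseed.d_dvd i k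
  obtain ⟨p', rfl⟩ : ∃ p', p'' = -p' := ⟨-p'', by ring⟩
  have hqpos : 0 < q' := by
    have : 0 < (d i : ℤ) * q' := by rw [← hq', hjq]; positivity
    exact pos_of_mul_pos_right this hdZ.le
  have hppos : 0 < p' := by
    have : 0 < (d i : ℤ) * p' := by
      have : (d i : ℤ) * -p' = -(p + 1) := by rw [← hp'', hkp]
      have h2 : (d i : ℤ) * p' = p + 1 := by linarith
      rw [h2]; positivity
    exact pos_of_mul_pos_right this hdZ.le
  refine ⟨∑ r ∈ Finset.Ico 1 (d i), Pcoef hmn d ρ B i r *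
    xv m (Fin.castLE hmn j) ^ ((r : ℤ) * q' - 1) *
        xv m (Fin.castLE hmn k) ^ (((d i : ℤ) - r) * p' - 1), ?_, ?_⟩
  · refine sum_mem fun r hr => ?_
    rw [Finset.mem_Ico] at hr
    refine mul_mem (mul_mem (Pcoef_mem hmn hseed i hr.2.le (fun _ _ => Set.mem_univ _))
      (zpow_mem_RR hmn (Set.mem_univ _) ?_)) (zpow_mem_RR hmn (Set.mem_univ _) ?_)
    · have : 0 < (r : ℤ) * q' := mul_pos (by omega) hqpos
      omega
    · have : 0 < ((d i : ℤ) - r) * p' := mul_pos (by omega) hppos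
      omega
  · have hterm := term_eq hmn hseed i j k hi hj hk hij hik hjk q' p' hqpos hppos hq' hp''
    have hj0 := xv_ne_zero m (Fin.castLE hmn j)
    have hk0 := xv_ne_zero m (Fin.castLE hmn k)
    unfold exchangeVar
    simp only [initSeed]
    congr 1
    rw [Finset.sum_range_succ, Finset.range_eq_Ico, Finset.sum_eq_sum_Ico_succ_bot hd,
      hterm 0 (Nat.zero_le _), hterm (d i) le_rfl]
    have eq1 : ((d i : ℕ) : ℤ) * q' = ((q + 1 : ℕ) : ℤ) := by
      rw [← hq', hjq]; push_cast; rfl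
    have eq2 : ((d i : ℤ) - ((0 : ℕ) : ℤ)) * p' = ((p + 1 : ℕ) : ℤ) := by
      have := hp''.symm.trans hkp
      push_cast; linarith
    rw [eq1, eq2, zpow_natCast, zpow_natCast, Nat.cast_zero, zero_mul, zpow_zero, sub_self,
      zero_mul, zpow_zero, mul_one, mul_one]
    congr 2
    rw [Finset.mul_sum]
    refine Finset.sum_congr rfl fun r hr => ?_
    rw [Finset.mem_Ico] at hr
    rw [hterm r hr.2.le, zpow_sub_one₀ hj0, zpow_sub_one₀ hk0]
    field_simp

/-- Elements of the polynomial ring are combinations of monomials. -/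
theorem RR_span {m n : ℕ} (hmn : n ≤ m) (T : Set (Fin n)) (z : K m)
    (N : Submodule (↥(ZP m n)) (K m))
    (hN : ∀ e : Fin n → ℕ, (∀ j, j ∉ T → e j = 0) →
      z * ∏ j : Fin n, xv m (Fin.castLE hmn j) ^ e j ∈ N) :
    ∀ a ∈ RR hmn T, z * a ∈ N := by
  have hmon : ∀ a ∈ Submonoid.closure {y | ∃ j : Fin n, j ∈ T ∧ y = xv m (Fin.castLE hmn j)},
      ∃ e : Fin n → ℕ, (∀ j, j ∉ T → e j = 0) ∧
        a = ∏ j : Fin n, xv m (Fin.castLE hmn j) ^ e j := by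
    intro a ha
    induction ha using Submonoid.closure_induction with
    | mem x hx =>
      obtain ⟨j, hj, rfl⟩ := hx
      refine ⟨Pi.single j 1, fun t ht => ?_, ?_⟩
      · rw [Pi.single_apply, if_neg]
        rintro rfl
        exact ht hj
      · rw [Finset.prod_eq_single j]
        · simp
        · intro b _ hb; simp [hb]
        · simp
    | one => exact ⟨0, by simp, by simp⟩
    | mul x y _ _ hx hy =>
      obtain ⟨e, he, rfl⟩ := hx
      obtain ⟨f, hf, rfl⟩ := hy
      refine ⟨e + f, fun j hj => by simp [he j hj, hf j hj], ?_⟩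
      rw [← Finset.prod_mul_distrib]
      simp [pow_add]
  intro a ha
  have ha' : a ∈ Subalgebra.toSubmodule (RR hmn T) := ha
  rw [RR, Algebra.adjoin_eq_span] at ha'
  induction ha' using Submodule.span_induction with
  | mem x hx =>
    obtain ⟨e, he, rfl⟩ := hmon x hx
    exact hN e he
  | zero => rw [mul_zero]; exact N.zero_mem
  | add x y hx hy h1 h2 =>
    rw [mul_add]
    refine N.add_mem (h1 ?_) (h2 ?_)
    · have : x ∈ Subalgebra.toSubmodule (RR hmn T) := by
        rw [RR, Algebra.adjoin_eq_span]; exact hx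
      exact this
    · have : y ∈ Subalgebra.toSubmodule (RR hmn T) := by
        rw [RR, Algebra.adjoin_eq_span]; exact hy
      exact this
  | smul c x hx h1 =>
    rw [mul_smul_comm]
    refine N.smul_mem c (h1 ?_)
    have : x ∈ Subalgebra.toSubmodule (RR hmn T) := by
      rw [RR, Algebra.adjoin_eq_span]; exact hx
    exact this

/-- The exponent vector of `x'_a x'_b x'_c` for the given finite set of indices. -/
def primeIdx {n : ℕ} (s : Finset (Fin n)) : StdIdx n :=
  ⟨fun i => (0, if i ∈ s then 1 else 0), fun _ => Or.inl rfl⟩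

theorem stdMon_primeIdx {m n : ℕ} (x x' : Fin n → K m) (s : Finset (Fin n)) :
    stdMon x x' (primeIdx s) = ∏ i ∈ s, x' i := by
  unfold stdMon primeIdx
  simp [Finset.prod_ite_mem, pow_ite]

/-- A single `x'_k` times a polynomial in the other cluster variables. -/
theorem single_mem {m n : ℕ} (hmn : n ≤ m) (x' : Fin n → K m) (k : Fin n)
    (v : StdIdx n) (l : Fin n) (hl : l ≠ k) (hv : (v.1 l).2 ≠ 0) :
    ∀ a ∈ RR hmn {j | j ≠ k}, x' k * a ∈ Submodule.span (↥(ZP m n))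
      (stdMon (fun i => xv m (Fin.castLE hmn i)) x' '' (Set.univ \ {v})) := by
  apply RR_span
  intro e he
  refine Submodule.subset_span
    ⟨⟨fun j => (e j, if j = k then 1 else 0), fun j => ?_⟩, ⟨Set.mem_univ _, ?_⟩, ?_⟩
  · by_cases h : j = k
    · left; exact he j (by simp [h])
    · right; simp [h]
  · rintro h
    apply hv
    rw [← show _ = v from h]
    simp [hl]
  · unfold stdMon
    simp only [Finset.prod_mul_distrib]
    rw [mul_comm]
    congr 1
    simp [pow_ite]

theorem poly_mem {m n : ℕ} (hmn : n ≤ m) (x' : Fin n → K m)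
    (v : StdIdx n) (l : Fin n) (hv : (v.1 l).2 ≠ 0) :
    ∀ a ∈ RR hmn Set.univ, a ∈ Submodule.span (↥(ZP m n))
      (stdMon (fun i => xv m (Fin.castLE hmn i)) x' '' (Set.univ \ {v})) := by
  intro a ha
  have := RR_span hmn Set.univ 1 (Submodule.span (↥(ZP m n))
      (stdMon (fun i => xv m (Fin.castLE hmn i)) x' '' (Set.univ \ {v}))) ?_ a ha
  · rwa [one_mul] at this
  intro e he
  refine Submodule.subset_span
    ⟨⟨fun j => (e j, 0), fun j => Or.inr rfl⟩, ⟨Set.mem_univ _, ?_⟩, ?_⟩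
  · rintro h
    apply hv
    rw [← show _ = v from h]
  · unfold stdMon
    simp

end GCA

open GCA in
/-- For a generalized seed with a 3-cycle `b_{32}, b_{21}, b_{13} > 0`,
the product `x'_1 x'_2 x'_3` expands as the stated combination of standard monomials plus
a polynomial `A ∈ ℤℙ[x₁,…,x_n]`; consequently the standard monomials in
`x₁,x'₁,…,x_n,x'_n` are linearly dependent over `ℤℙ`. -/
theorem three_cycle_dependence {m n : ℕ} (hn : 3 ≤ n) (hmn : n ≤ m)
    (d : Fin n → ℕ) (ρ : Fin n → ℕ → K m) (B : Matrix (Fin m) (Fin n) ℤ)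
    (hseed : SeedHyps m n hmn d ρ B)
    (i1 : Fin n) (i2 : Fin n) (i3 : Fin n)
    (h1 : (i1 : ℕ) = 0) (h2 : (i2 : ℕ) = 1) (h3 : (i3 : ℕ) = 2)
    (hb32 : 0 < B (Fin.castLE hmn i3) i2) (hb21 : 0 < B (Fin.castLE hmn i2) i1)
    (hb13 : 0 < B (Fin.castLE hmn i1) i3) :
    (∃ A ∈ Algebra.adjoin (↥(ZP m n)) {y | ∃ j : Fin n, y = xv m (Fin.castLE hmn j)},
      exchangeVar hmn d (initSeed m n ρ B) i1 * exchangeVar hmn d (initSeed m n ρ B) i2 *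
          exchangeVar hmn d (initSeed m n ρ B) i3 =
        Pcoef hmn d ρ B i1 0 * Pcoef hmn d ρ B i3 (d i3) *
            exchangeVar hmn d (initSeed m n ρ B) i2 *
            xv m (Fin.castLE hmn i1) ^ (B (Fin.castLE hmn i1) i3 - 1) *
            xv m (Fin.castLE hmn i3) ^ (-B (Fin.castLE hmn i3) i1 - 1) +
          Pcoef hmn d ρ B i1 (d i1) * Pcoef hmn d ρ B i2 0 *
            xv m (Fin.castLE hmn i1) ^ (-B (Fin.castLE hmn i1) i2 - 1) *
            xv m (Fin.castLE hmn i2) ^ (B (Fin.castLE hmn i2) i1 - 1) *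
            exchangeVar hmn d (initSeed m n ρ B) i3 +
          Pcoef hmn d ρ B i2 (d i2) * Pcoef hmn d ρ B i3 0 *
            exchangeVar hmn d (initSeed m n ρ B) i1 *
            xv m (Fin.castLE hmn i2) ^ (-B (Fin.castLE hmn i2) i3 - 1) *
            xv m (Fin.castLE hmn i3) ^ (B (Fin.castLE hmn i3) i2 - 1) +
          A) ∧
      ¬ LinearIndependent (↥(ZP m n))
          (stdMon (fun i => xv m (Fin.castLE hmn i))
            (exchangeVar hmn d (initSeed m n ρ B))) := by
  obtain ⟨D, hD, hs⟩ := hseed.skew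
  have neg_of : ∀ i j : Fin n, 0 < B (Fin.castLE hmn i) j → B (Fin.castLE hmn j) i < 0 := by
    intro i j h
    have h1 := hs i j
    have h2 := mul_pos (hD i) h
    have h3 : 0 < D j * (-B (Fin.castLE hmn j) i) := by linarith
    have := pos_of_mul_pos_right h3 (hD j).le
    omega
  have hb23 := neg_of _ _ hb32
  have hb12 := neg_of _ _ hb21
  have hb31 := neg_of _ _ hb13
  have n12 : i1 ≠ i2 := by rw [Ne, Fin.ext_iff]; omega
  have n13 : i1 ≠ i3 := by rw [Ne, Fin.ext_iff]; omega
  have n23 : i2 ≠ i3 := by rw [Ne, Fin.ext_iff]; omega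
  obtain ⟨e32, he32⟩ : ∃ e : ℕ, B (Fin.castLE hmn i3) i2 = e + 1 :=
    ⟨(B (Fin.castLE hmn i3) i2 - 1).toNat, by omega⟩
  obtain ⟨e21, he21⟩ : ∃ e : ℕ, B (Fin.castLE hmn i2) i1 = e + 1 :=
    ⟨(B (Fin.castLE hmn i2) i1 - 1).toNat, by omega⟩
  obtain ⟨e13, he13⟩ : ∃ e : ℕ, B (Fin.castLE hmn i1) i3 = e + 1 :=
    ⟨(B (Fin.castLE hmn i1) i3 - 1).toNat, by omega⟩
  obtain ⟨e23, he23⟩ : ∃ e : ℕ, B (Fin.castLE hmn i2) i3 = -(e + 1) :=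
    ⟨(-B (Fin.castLE hmn i2) i3 - 1).toNat, by omega⟩
  obtain ⟨e12, he12⟩ : ∃ e : ℕ, B (Fin.castLE hmn i1) i2 = -(e + 1) :=
    ⟨(-B (Fin.castLE hmn i1) i2 - 1).toNat, by omega⟩
  obtain ⟨e31, he31⟩ : ∃ e : ℕ, B (Fin.castLE hmn i3) i1 = -(e + 1) :=
    ⟨(-B (Fin.castLE hmn i3) i1 - 1).toNat, by omega⟩
  obtain ⟨M1, hM1, hx1⟩ := exch_eq hmn hseed i1 i2 i3 (by omega) (by omega) (by omega)
    n12 n13 n23 e21 e31 he21 he31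
  obtain ⟨M2, hM2, hx2⟩ := exch_eq hmn hseed i2 i3 i1 (by omega) (by omega) (by omega)
    n23 n12.symm n13.symm e32 e12 he32 he12
  obtain ⟨M3, hM3, hx3⟩ := exch_eq hmn hseed i3 i1 i2 (by omega) (by omega) (by omega)
    n13.symm n23.symm n12 e13 e23 he13 he23
  have hP : ∀ (T : Set (Fin n)) (hT : ∀ j : Fin n, 3 ≤ (j : ℕ) → j ∈ T) (i : Fin n) (r : ℕ),
      r ≤ d i → Pcoef hmn d ρ B i r ∈ RR hmn T := fun T hT i r hr => Pcoef_mem hmn hseed i hr hT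
  have hRR : Algebra.adjoin (↥(ZP m n)) {y | ∃ j : Fin n, y = xv m (Fin.castLE hmn j)} =
      RR hmn Set.univ := by
    simp [RR]
  have z1 := xv_ne_zero m (Fin.castLE hmn i1)
  have z2 := xv_ne_zero m (Fin.castLE hmn i2)
  have z3 := xv_ne_zero m (Fin.castLE hmn i3)
  have w13 : B (Fin.castLE hmn i1) i3 - 1 = (e13 : ℤ) := by omega
  have w31 : -B (Fin.castLE hmn i3) i1 - 1 = (e31 : ℤ) := by omega
  have w12 : -B (Fin.castLE hmn i1) i2 - 1 = (e12 : ℤ) := by omega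
  have w21 : B (Fin.castLE hmn i2) i1 - 1 = (e21 : ℤ) := by omega
  have w23 : -B (Fin.castLE hmn i2) i3 - 1 = (e23 : ℤ) := by omega
  have w32 : B (Fin.castLE hmn i3) i2 - 1 = (e32 : ℤ) := by omega
  rw [hRR, w13, w31, w12, w21, w23, w32]
  simp only [zpow_natCast]
  have key : ∃ A ∈ RR hmn (Set.univ : Set (Fin n)),
      exchangeVar hmn d (initSeed m n ρ B) i1 * exchangeVar hmn d (initSeed m n ρ B) i2 *
          exchangeVar hmn d (initSeed m n ρ B) i3 =
        Pcoef hmn d ρ B i1 0 * Pcoef hmn d ρ B i3 (d i3) *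
            exchangeVar hmn d (initSeed m n ρ B) i2 *
            xv m (Fin.castLE hmn i1) ^ e13 *
            xv m (Fin.castLE hmn i3) ^ e31 +
          Pcoef hmn d ρ B i1 (d i1) * Pcoef hmn d ρ B i2 0 *
            xv m (Fin.castLE hmn i1) ^ e12 *
            xv m (Fin.castLE hmn i2) ^ e21 *
            exchangeVar hmn d (initSeed m n ρ B) i3 +
          Pcoef hmn d ρ B i2 (d i2) * Pcoef hmn d ρ B i3 0 *
            exchangeVar hmn d (initSeed m n ρ B) i1 *
            xv m (Fin.castLE hmn i2) ^ e23 *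
            xv m (Fin.castLE hmn i3) ^ e32 +
          A := by
    have q10 := hP Set.univ (fun _ _ => Set.mem_univ _) i1 0 (Nat.zero_le _)
    have q20 := hP Set.univ (fun _ _ => Set.mem_univ _) i2 0 (Nat.zero_le _)
    have q30 := hP Set.univ (fun _ _ => Set.mem_univ _) i3 0 (Nat.zero_le _)
    have q1d := hP Set.univ (fun _ _ => Set.mem_univ _) i1 (d i1) le_rfl
    have q2d := hP Set.univ (fun _ _ => Set.mem_univ _) i2 (d i2) le_rfl
    have q3d := hP Set.univ (fun _ _ => Set.mem_univ _) i3 (d i3) le_rfl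
    have m1 : xv m (Fin.castLE hmn i1) ∈ RR hmn Set.univ := xv_mem_RR hmn (Set.mem_univ _)
    have m2 : xv m (Fin.castLE hmn i2) ∈ RR hmn Set.univ := xv_mem_RR hmn (Set.mem_univ _)
    have m3 : xv m (Fin.castLE hmn i3) ∈ RR hmn Set.univ := xv_mem_RR hmn (Set.mem_univ _)
    rw [hx1, hx2, hx3]
    generalize Pcoef hmn d ρ B i1 0 = P10 at *
    generalize Pcoef hmn d ρ B i2 0 = P20 at *
    generalize Pcoef hmn d ρ B i3 0 = P30 at *
    generalize Pcoef hmn d ρ B i1 (d i1) = P1d at *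
    generalize Pcoef hmn d ρ B i2 (d i2) = P2d at *
    generalize Pcoef hmn d ρ B i3 (d i3) = P3d at *
    generalize xv m (Fin.castLE hmn i1) = x1 at *
    generalize xv m (Fin.castLE hmn i2) = x2 at *
    generalize xv m (Fin.castLE hmn i3) = x3 at *
    clear hx1 hx2 hx3
    -- write a1 = x3 * a1, c1 = x2 * c1, and cyclically
    refine ⟨P10 * x3 ^ e31 * (P20 * x1 ^ e12) * (P30 * x2 ^ e23)
      + P10 * x3 ^ e31 * (P20 * x1 ^ e12) * (x1 * M3)
      + P10 * x3 ^ e31 * (x3 * M2) * (P30 * x2 ^ e23)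
      + P10 * x3 ^ e31 * (x1 * x3 * M2) * M3
      + P10 * x3 ^ e31 * (P2d * x3 ^ e32) * (x3 * M3)
      + x3 ^ 0 * M1 * (P20 * x1 ^ e12) * (P30 * x2 ^ e23 * x2)
      + M1 * (P20 * x1 ^ e12) * (x1 * x2 * M3)
      + M1 * (P20 * x1 ^ e12) * (P3d * x1 ^ e13 * x1)
      + M1 * (x3 * M2) * (P30 * x2 ^ e23 * x2)
      + M1 * (x1 * x3 * M2) * (x2 * M3)
      + M1 * (x3 * M2) * (P3d * x1 ^ e13 * x1)
      + M1 * (P2d * x3 ^ e32 * x3) * (x2 * M3)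
      + M1 * (P2d * x3 ^ e32 * x3) * (P3d * x1 ^ e13)
      + P1d * x2 ^ e21 * M2 * (P30 * x2 ^ e23 * x2)
      + P1d * x2 ^ e21 * M2 * (x1 * x2 * M3)
      + P1d * x2 ^ e21 * M2 * (P3d * x1 ^ e13 * x1)
      + P1d * x2 ^ e21 * (P2d * x3 ^ e32) * (x2 * M3)
      + P1d * x2 ^ e21 * (P2d * x3 ^ e32) * (P3d * x1 ^ e13), ?_, ?_⟩
    · repeat' first | assumption | apply add_mem | apply mul_mem | apply pow_mem
    · field_simp
      ring
  refine ⟨key, ?_⟩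
  obtain ⟨A, hA, hE⟩ := key
  intro hli
  set x' := exchangeVar hmn d (initSeed m n ρ B) with hx'
  let v : StdIdx n := primeIdx {i1, i2, i3}
  have hv : ∀ l ∈ ({i1, i2, i3} : Finset (Fin n)), (v.1 l).2 ≠ 0 := by
    intro l hl
    simp only [v, primeIdx, if_pos hl]
    exact one_ne_zero
  have hvm : stdMon (fun i => xv m (Fin.castLE hmn i)) x' v = x' i1 * x' i2 * x' i3 := by
    simp only [v]
    rw [stdMon_primeIdx, Finset.prod_insert (by simp [n12, n13]),
      Finset.prod_insert (by simp [n23]), Finset.prod_singleton, mul_assoc]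
  refine hli.notMem_span_image (s := Set.univ \ {v}) (x := v) (by simp) ?_
  rw [hvm, hE]
  have hge : ∀ (k : Fin n), (k : ℕ) < 3 → ∀ j : Fin n, 3 ≤ (j : ℕ) → j ∈ {j : Fin n | j ≠ k} := by
    intro k hk j hj
    simp only [Set.mem_setOf_eq, Ne, Fin.ext_iff]
    omega
  refine Submodule.add_mem _ (Submodule.add_mem _ (Submodule.add_mem _ ?_ ?_) ?_) ?_
  · have := single_mem hmn x' i2 v i1 n12 (hv _ (by simp))
      (Pcoef hmn d ρ B i1 0 * Pcoef hmn d ρ B i3 (d i3) * xv m (Fin.castLE hmn i1) ^ e13 *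
            xv m (Fin.castLE hmn i3) ^ e31)
      (mul_mem (mul_mem (mul_mem (hP _ (hge _ (by omega)) _ _ (Nat.zero_le _))
        (hP _ (hge _ (by omega)) _ _ le_rfl)) (pow_mem (xv_mem_RR hmn n12) _))
        (pow_mem (xv_mem_RR hmn n23.symm) _))
    convert this using 1
    ring
  · have := single_mem hmn x' i3 v i1 n13 (hv _ (by simp))
      (Pcoef hmn d ρ B i1 (d i1) * Pcoef hmn d ρ B i2 0 * xv m (Fin.castLE hmn i1) ^ e12 *
            xv m (Fin.castLE hmn i2) ^ e21)
      (mul_mem (mul_mem (mul_mem (hP _ (hge _ (by omega)) _ _ le_rfl)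
        (hP _ (hge _ (by omega)) _ _ (Nat.zero_le _))) (pow_mem (xv_mem_RR hmn n13) _))
        (pow_mem (xv_mem_RR hmn n23) _))
    convert this using 1
    ring
  · have := single_mem hmn x' i1 v i2 n12.symm (hv _ (by simp))
      (Pcoef hmn d ρ B i2 (d i2) * Pcoef hmn d ρ B i3 0 * xv m (Fin.castLE hmn i2) ^ e23 *
            xv m (Fin.castLE hmn i3) ^ e32)
      (mul_mem (mul_mem (mul_mem (hP _ (hge _ (by omega)) _ _ le_rfl)
        (hP _ (hge _ (by omega)) _ _ (Nat.zero_le _))) (pow_mem (xv_mem_RR hmn n12.symm) _))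
        (pow_mem (xv_mem_RR hmn n13.symm) _))
    convert this using 1
    ring
  · exact poly_mem hmn x' v i1 (hv _ (by simp)) A hA
end

section
/- In the rational function field ℚ(x_1,x_2,x_3), let h, d, l be integers and set x'_1 = x_1^{-1}(x_2^2 + h x_2 x_3 + x_3^2), x'_2 = x_2^{-1}(x_1 + x_3), and x'_3 = x_3^{-1}(x_1^3 + l x_1^2 x_2 + d x_1 x_2^2 + x_2^3). Then x'_1 x'_2 x'_3 = x'_1 x_2^2 + x'_2 x_1^2 x_3 + x'_3 x_2 + (hl+1)x_1^2 x_2 + (l+hd)x_1 x_2^2 + (h+l)x_1^2 x_3 + l x_1 x_3^2 + (hd+1)x_2^2 x_3 + d x_2 x_3^2 + (d+hl)x_1 x_2 x_3 + h x_1^3 + (h+d)x_2^3. In particular, the standard monomials in x_1, x'_1, x_2, x'_2, x_3, x'_3 are linearly dependent over ℤ. -/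
namespace GCAExample

/-- The field `ℚ(x₁,x₂,x₃)`. -/
abbrev K3 : Type := FractionRing (MvPolynomial (Fin 3) ℚ)

/-- The variables `x₁, x₂, x₃`. -/
noncomputable def x (i : Fin 3) : K3 :=
  algebraMap (MvPolynomial (Fin 3) ℚ) K3 (MvPolynomial.X i)

/-- The exchanged cluster variables `x'₁, x'₂, x'₃` of the cyclic generalized seed. -/
noncomputable def x' (h d l : ℤ) : Fin 3 → K3 :=
  ![(x 0)⁻¹ * (x 1 ^ 2 + (h : K3) * x 1 * x 2 + x 2 ^ 2),
    (x 1)⁻¹ * (x 0 + x 2),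
    (x 2)⁻¹ * (x 0 ^ 3 + (l : K3) * x 0 ^ 2 * x 1 + (d : K3) * x 0 * x 1 ^ 2 + x 1 ^ 3)]

/-- Index type for standard monomials: exponent pairs with no product `x_i x'_i`. -/
def StdIdx3 : Type := {v : Fin 3 → ℕ × ℕ // ∀ i, (v i).1 = 0 ∨ (v i).2 = 0}

/-- The standard monomial attached to an exponent vector. -/
noncomputable def stdMon (h d l : ℤ) (v : StdIdx3) : K3 :=
  ∏ i : Fin 3, x i ^ (v.1 i).1 * x' h d l i ^ (v.1 i).2

end GCAExample

namespace GCAExample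

/-- The variables are nonzero. -/
lemma x_ne_zero (i : Fin 3) : x i ≠ 0 := by
  unfold x
  intro h
  exact MvPolynomial.X_ne_zero (R := ℚ) i
    ((IsFractionRing.injective (MvPolynomial (Fin 3) ℚ) K3) (by rw [h, map_zero]))

/-- A standard monomial index from six exponents. -/
def mkIdx (a a' b b' c c' : ℕ) (ha : a = 0 ∨ a' = 0) (hb : b = 0 ∨ b' = 0)
    (hc : c = 0 ∨ c' = 0) : StdIdx3 :=
  ⟨![(a, a'), (b, b'), (c, c')], by
    intro i
    fin_cases i
    · exact ha
    · exact hb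
    · exact hc⟩

lemma stdMon_mkIdx (h d l : ℤ) (a a' b b' c c' : ℕ) (ha : a = 0 ∨ a' = 0)
    (hb : b = 0 ∨ b' = 0) (hc : c = 0 ∨ c' = 0) :
    stdMon h d l (mkIdx a a' b b' c c' ha hb hc) =
      (x 0 ^ a * x' h d l 0 ^ a') * (x 1 ^ b * x' h d l 1 ^ b') *
        (x 2 ^ c * x' h d l 2 ^ c') := by
  simp [stdMon, mkIdx, Fin.prod_univ_three]

/-- Integer multiples of standard monomials other than `x'₁x'₂x'₃` lie in their span. -/
lemma mem_span_aux (h d l n : ℤ) (a a' b b' c c' : ℕ) (ha : a = 0 ∨ a' = 0)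
    (hb : b = 0 ∨ b' = 0) (hc : c = 0 ∨ c' = 0) (hne : a' = 0 ∨ b' = 0 ∨ c' = 0)
    (y : K3) (hy : y = (n : K3) * ((x 0 ^ a * x' h d l 0 ^ a') *
      (x 1 ^ b * x' h d l 1 ^ b') * (x 2 ^ c * x' h d l 2 ^ c'))) :
    y ∈ Submodule.span ℤ (stdMon h d l ''
      {mkIdx 0 1 0 1 0 1 (Or.inl rfl) (Or.inl rfl) (Or.inl rfl)}ᶜ) := by
  rw [hy, ← stdMon_mkIdx h d l a a' b b' c c' ha hb hc, ← zsmul_eq_mul]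
  refine Submodule.smul_mem _ _ (Submodule.subset_span ⟨_, ?_, rfl⟩)
  intro heq
  have h1 := congrArg Subtype.val (Set.mem_singleton_iff.mp heq)
  have e0 := congrFun h1 0
  have e1 := congrFun h1 1
  have e2 := congrFun h1 2
  simp [mkIdx] at e0 e1 e2
  omega

end GCAExample

open GCAExample in
/-- In `ℚ(x₁,x₂,x₃)` with
`x'₁ = x₁⁻¹(x₂² + h x₂x₃ + x₃²)`, `x'₂ = x₂⁻¹(x₁ + x₃)`,
`x'₃ = x₃⁻¹(x₁³ + l x₁²x₂ + d x₁x₂² + x₂³)`, the product `x'₁x'₂x'₃` expands as stated;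
in particular the standard monomials in `x₁,x'₁,x₂,x'₂,x₃,x'₃` are linearly dependent
over `ℤ`. -/
theorem cyclic_example (h d l : ℤ) :
    (x' h d l 0 * x' h d l 1 * x' h d l 2 =
      x' h d l 0 * x 1 ^ 2 + x' h d l 1 * x 0 ^ 2 * x 2 + x' h d l 2 * x 1 +
        ((h * l + 1 : ℤ) : K3) * x 0 ^ 2 * x 1 + ((l + h * d : ℤ) : K3) * x 0 * x 1 ^ 2 +
        ((h + l : ℤ) : K3) * x 0 ^ 2 * x 2 + (l : K3) * x 0 * x 2 ^ 2 +
        ((h * d + 1 : ℤ) : K3) * x 1 ^ 2 * x 2 + (d : K3) * x 1 * x 2 ^ 2 +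
        ((d + h * l : ℤ) : K3) * x 0 * x 1 * x 2 +
        (h : K3) * x 0 ^ 3 + ((h + d : ℤ) : K3) * x 1 ^ 3) ∧
      ¬ LinearIndependent ℤ (stdMon h d l) := by
  have h0 := x_ne_zero 0
  have h1 := x_ne_zero 1
  have h2 := x_ne_zero 2
  have main : (x' h d l 0 * x' h d l 1 * x' h d l 2 =
      x' h d l 0 * x 1 ^ 2 + x' h d l 1 * x 0 ^ 2 * x 2 + x' h d l 2 * x 1 +
        ((h * l + 1 : ℤ) : K3) * x 0 ^ 2 * x 1 + ((l + h * d : ℤ) : K3) * x 0 * x 1 ^ 2 +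
        ((h + l : ℤ) : K3) * x 0 ^ 2 * x 2 + (l : K3) * x 0 * x 2 ^ 2 +
        ((h * d + 1 : ℤ) : K3) * x 1 ^ 2 * x 2 + (d : K3) * x 1 * x 2 ^ 2 +
        ((d + h * l : ℤ) : K3) * x 0 * x 1 * x 2 +
        (h : K3) * x 0 ^ 3 + ((h + d : ℤ) : K3) * x 1 ^ 3) := by
    simp only [x', Matrix.cons_val_zero, Matrix.cons_val_one, Matrix.cons_val]
    push_cast
    generalize x 0 = a at *
    generalize x 1 = b at *
    generalize x 2 = c at *
    field_simp
    ring
  refine ⟨main, fun hli => ?_⟩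
  refine hli.notMem_span_image (s := {mkIdx 0 1 0 1 0 1 (Or.inl rfl) (Or.inl rfl) (Or.inl rfl)}ᶜ)
    (x := mkIdx 0 1 0 1 0 1 (Or.inl rfl) (Or.inl rfl) (Or.inl rfl)) (fun hm => hm rfl) ?_
  have e : stdMon h d l (mkIdx 0 1 0 1 0 1 (Or.inl rfl) (Or.inl rfl) (Or.inl rfl)) =
      x' h d l 0 * x' h d l 1 * x' h d l 2 := by
    rw [stdMon_mkIdx]; ring
  rw [e, main]
  refine add_mem (add_mem (add_mem (add_mem (add_mem (add_mem (add_mem (add_mem (add_mem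
    (add_mem (add_mem ?_ ?_) ?_) ?_) ?_) ?_) ?_) ?_) ?_) ?_) ?_) ?_
  · exact mem_span_aux h d l 1 0 1 2 0 0 0 (by simp) (by simp) (by simp) (by simp) _
      (by push_cast; ring)
  · exact mem_span_aux h d l 1 2 0 0 1 1 0 (by simp) (by simp) (by simp) (by simp) _
      (by push_cast; ring)
  · exact mem_span_aux h d l 1 0 0 1 0 0 1 (by simp) (by simp) (by simp) (by simp) _
      (by push_cast; ring)
  · exact mem_span_aux h d l (h * l + 1) 2 0 1 0 0 0 (by simp) (by simp) (by simp) (by simp) _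
      (by push_cast; ring)
  · exact mem_span_aux h d l (l + h * d) 1 0 2 0 0 0 (by simp) (by simp) (by simp) (by simp) _
      (by push_cast; ring)
  · exact mem_span_aux h d l (h + l) 2 0 0 0 1 0 (by simp) (by simp) (by simp) (by simp) _
      (by push_cast; ring)
  · exact mem_span_aux h d l l 1 0 0 0 2 0 (by simp) (by simp) (by simp) (by simp) _
      (by push_cast; ring)
  · exact mem_span_aux h d l (h * d + 1) 0 0 2 0 1 0 (by simp) (by simp) (by simp) (by simp) _
      (by push_cast; ring)
  · exact mem_span_aux h d l d 0 0 1 0 2 0 (by simp) (by simp) (by simp) (by simp) _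
      (by push_cast; ring)
  · exact mem_span_aux h d l (d + h * l) 1 0 1 0 1 0 (by simp) (by simp) (by simp) (by simp) _
      (by push_cast; ring)
  · exact mem_span_aux h d l h 3 0 0 0 0 0 (by simp) (by simp) (by simp) (by simp) _
      (by push_cast; ring)
  · exact mem_span_aux h d l (h + d) 0 0 3 0 0 0 (by simp) (by simp) (by simp) (by simp) _
      (by push_cast; ring)
end
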